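/- arXiv:2405.07688 — 6 statements merged into one kernel-verified Lean document; each statement's English description precedes it below -/
import Mathlib

section
/- Let G be a finitely generated group and let μ be a symmetric, non-degenerate probability measure on G which generates a transient random walk. Let S ⊆ supp(μ) be a finite symmetric generating set for G, let |·| denote word length with respect to S, and set ρ := min_{s∈S} μ(s) ∈ (0,1]. Assume there exists ρ₀ < ρ such that ∑_{g∈G} μ(g) ρ₀^{-|g|} < ∞. If (G,μ) has the strong Liouville property, then for all a,b ∈ G and for every exhaustion (S_n) of G, Δ(S_n;a,b) → 0 as n → ∞. -/
open Filter Topology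

noncomputable section

/- Convolution powers of a measure `μ` on a group: `convPow μ 0 = δ_e`,
`convPow μ (n+1) x = ∑_g convPow μ n g * μ (g⁻¹ x)`. -/
open Classical in
def convPow {G : Type*} [Group G] (μ : G → ℝ) : ℕ → G → ℝ
  | 0 => fun x => if x = 1 then 1 else 0
  | n + 1 => fun x => ∑' g : G, convPow μ n g * μ (g⁻¹ * x)

/-- The Green function `G(x,y) = ∑_{n≥0} μ^{(n)}(x⁻¹ y)`. -/
def green {G : Type*} [Group G] (μ : G → ℝ) (x y : G) : ℝ :=
  ∑' n : ℕ, convPow μ n (x⁻¹ * y)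

/-- `μ` is a probability measure on `G`. -/
def IsProbMeasure {G : Type*} (μ : G → ℝ) : Prop :=
  (∀ g, 0 ≤ μ g) ∧ HasSum μ 1

/-- `μ` is symmetric: `μ(g) = μ(g⁻¹)`. -/
def IsSymmetricMeasure {G : Type*} [Group G] (μ : G → ℝ) : Prop :=
  ∀ g : G, μ g = μ g⁻¹

/-- `μ` is non-degenerate: its support generates `G` as a semigroup. -/
def IsNonDegenerate {G : Type*} [Group G] (μ : G → ℝ) : Prop :=
  Subsemigroup.closure {g : G | μ g ≠ 0} = ⊤

/-- Transience: the Green function is finite, i.e. the series converges. -/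
def IsTransient {G : Type*} [Group G] (μ : G → ℝ) : Prop :=
  ∀ x y : G, Summable fun n : ℕ => convPow μ n (x⁻¹ * y)

/-- `f` is `μ`-harmonic: for every `k`, `∑_g μ(g) f(kg)` converges (absolutely,
since in `ℝ` summability is absolute) to `f k`. -/
def IsHarmonic {G : Type*} [Group G] (μ : G → ℝ) (f : G → ℝ) : Prop :=
  ∀ k : G, HasSum (fun g : G => μ g * f (k * g)) (f k)

/-- Word length of `x` with respect to a generating set `S`. -/
def wordLength {G : Type*} [Group G] (S : Set G) (x : G) : ℕ :=
  sInf {n : ℕ | ∃ l : List G, l.length = n ∧ (∀ a ∈ l, a ∈ S) ∧ l.prod = x}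

/-- Outer boundary of `F` with respect to the generating set `T`:
`∂F = {x ∉ F : ∃ y ∈ F, t ∈ T, x = y t}`. -/
def outerBoundary {G : Type*} [Group G] (T : Set G) (F : Set G) : Set G :=
  {x : G | x ∉ F ∧ ∃ y ∈ F, ∃ t ∈ T, x = y * t}

/-- The Green-variation functional
`Δ(F;a,b) = max_{x ∈ ∂F} |G(a,x) − G(b,x)| / G(a,x)`. -/
def greenDelta {G : Type*} [Group G] (μ : G → ℝ) (T : Set G) (F : Set G) (a b : G) : ℝ :=
  sSup ((fun x => |green μ a x - green μ b x| / green μ a x) '' outerBoundary T F)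

open scoped ENNReal

section ExtendedGreen

variable {G : Type*} [Group G]

open Classical in
/-- Convolution powers of an `ℝ≥0∞`-valued function on a group. -/
def extConvPow (ν : G → ℝ≥0∞) : ℕ → G → ℝ≥0∞
  | 0 => fun x => if x = 1 then 1 else 0
  | n + 1 => fun x => ∑' g : G, extConvPow ν n g * ν (g⁻¹ * x)

/-- The `ℝ≥0∞`-valued Green function. -/
def extGreen (ν : G → ℝ≥0∞) (x y : G) : ℝ≥0∞ :=
  ∑' n : ℕ, extConvPow ν n (x⁻¹ * y)

theorem tsum_extConvPow {ν : G → ℝ≥0∞} (hν : ∑' g, ν g = 1) (n : ℕ) :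
    ∑' x, extConvPow ν n x = 1 := by
  induction n with
  | zero => simp [extConvPow]
  | succ n ih =>
    simp only [extConvPow]
    rw [ENNReal.tsum_comm]
    have key (g : G) : ∑' x, extConvPow ν n g * ν (g⁻¹ * x) = extConvPow ν n g := by
      have hg : ∑' x, ν (g⁻¹ * x) = ∑' x, ν x := (Equiv.mulLeft g⁻¹).tsum_eq ν
      rw [ENNReal.tsum_mul_left, hg, hν, mul_one]
    simp only [key, ih]

theorem extConvPow_ne_top {ν : G → ℝ≥0∞} (hν : ∑' g, ν g = 1) (n : ℕ) (x : G) :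
    extConvPow ν n x ≠ ∞ :=
  ENNReal.ne_top_of_tsum_ne_top (by simp [tsum_extConvPow hν n]) x

theorem extConvPow_succ_left (ν : G → ℝ≥0∞) (n : ℕ) (x : G) :
    extConvPow ν (n + 1) x = ∑' g, ν g * extConvPow ν n (g⁻¹ * x) := by
  induction n generalizing x with
  | zero =>
    have hl : extConvPow ν 1 x = ν x := by
      simp only [extConvPow]
      rw [tsum_eq_single 1 (by intro g hg; simp [hg])]
      simp
    have hr : ∑' g, ν g * extConvPow ν 0 (g⁻¹ * x) = ν x := by
      simp only [extConvPow]
      rw [tsum_eq_single x (by intro g hg; simp [inv_mul_eq_one, hg])]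
      simp
    rw [hl, hr]
  | succ n ih =>
    rw [extConvPow]
    simp only [ih, ← ENNReal.tsum_mul_right]
    rw [ENNReal.tsum_comm]
    refine tsum_congr fun h => ?_
    rw [← ih, extConvPow, ← ENNReal.tsum_mul_left, ← (Equiv.mulLeft h).tsum_eq]
    refine tsum_congr fun g => ?_
    simp [mul_assoc]

theorem extGreen_eq (ν : G → ℝ≥0∞) (k x : G) :
    extGreen ν k x = extConvPow ν 0 (k⁻¹ * x) + ∑' g, ν g * extGreen ν (k * g) x := by
  rw [extGreen, tsum_eq_zero_add' ENNReal.summable]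
  congr 1
  simp only [extGreen, extConvPow_succ_left, ← ENNReal.tsum_mul_left]
  rw [ENNReal.tsum_comm]
  simp [mul_assoc]

end ExtendedGreen

section Green

variable {G : Type*} [Group G] {μ : G → ℝ}

theorem IsProbMeasure.tsum_ofReal {G : Type*} {μ : G → ℝ} (hprob : IsProbMeasure μ) :
    ∑' g, ENNReal.ofReal (μ g) = 1 := by
  rw [← ENNReal.ofReal_tsum_of_nonneg hprob.1 hprob.2.summable, hprob.2.tsum_eq,
    ENNReal.ofReal_one]

theorem toReal_extConvPow (hprob : IsProbMeasure μ) (n : ℕ) (x : G) :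
    (extConvPow (fun g => ENNReal.ofReal (μ g)) n x).toReal = convPow μ n x := by
  induction n generalizing x with
  | zero => simp only [extConvPow, convPow]; split_ifs <;> simp
  | succ n ih =>
    rw [extConvPow, convPow, ENNReal.tsum_toReal_eq]
    · simp [ih, hprob.1]
    · exact fun g => ENNReal.mul_ne_top (extConvPow_ne_top hprob.tsum_ofReal n g)
        ENNReal.ofReal_ne_top

theorem convPow_nonneg (hprob : IsProbMeasure μ) (n : ℕ) (x : G) : 0 ≤ convPow μ n x :=
  toReal_extConvPow hprob n x ▸ ENNReal.toReal_nonneg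

theorem extGreen_eq_ofReal (hprob : IsProbMeasure μ) (htr : IsTransient μ) (x y : G) :
    extGreen (fun g => ENNReal.ofReal (μ g)) x y = ENNReal.ofReal (green μ x y) := by
  rw [green, ENNReal.ofReal_tsum_of_nonneg (fun n => convPow_nonneg hprob n _) (htr x y), extGreen]
  refine tsum_congr fun n => ?_
  rw [← toReal_extConvPow hprob, ENNReal.ofReal_toReal (extConvPow_ne_top hprob.tsum_ofReal n _)]

theorem green_nonneg (hprob : IsProbMeasure μ) (x y : G) : 0 ≤ green μ x y :=
  tsum_nonneg fun n => convPow_nonneg hprob n _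

theorem hasSum_mul_green (hprob : IsProbMeasure μ) (htr : IsTransient μ) (k x : G) :
    HasSum (fun g => μ g * green μ (k * g) x) (green μ k x - convPow μ 0 (k⁻¹ * x)) := by
  have h := extGreen_eq (fun g => ENNReal.ofReal (μ g)) k x
  simp only [extGreen_eq_ofReal hprob htr, ← ENNReal.ofReal_mul (hprob.1 _)] at h
  have hfin : ∑' g, ENNReal.ofReal (μ g * green μ (k * g) x) ≠ ∞ := fun htop => by
    simp [htop] at h
  have hnn (g : G) : 0 ≤ μ g * green μ (k * g) x :=
    mul_nonneg (hprob.1 g) (green_nonneg hprob _ _)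
  have hsum : Summable fun g => μ g * green μ (k * g) x := by
    simpa [ENNReal.toReal_ofReal (hnn _)] using ENNReal.summable_toReal hfin
  convert hsum.hasSum using 1
  rw [← ENNReal.ofReal_tsum_of_nonneg hnn hsum] at h
  have h' := congrArg ENNReal.toReal h
  rw [ENNReal.toReal_add (extConvPow_ne_top hprob.tsum_ofReal 0 _) ENNReal.ofReal_ne_top,
    toReal_extConvPow hprob, ENNReal.toReal_ofReal (green_nonneg hprob _ _),
    ENNReal.toReal_ofReal (tsum_nonneg hnn)] at h'
  linarith

theorem mul_green_le_green (hprob : IsProbMeasure μ) (htr : IsTransient μ) (k s x : G) :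
    μ s * green μ (k * s) x ≤ green μ k x := by
  have h := le_hasSum (hasSum_mul_green hprob htr k x) s fun g _ =>
    mul_nonneg (hprob.1 g) (green_nonneg hprob _ _)
  linarith [convPow_nonneg hprob 0 (k⁻¹ * x)]

theorem one_le_green_self (hprob : IsProbMeasure μ) (htr : IsTransient μ) (x : G) :
    1 ≤ green μ x x := by
  have h := (hasSum_mul_green hprob htr x x).nonneg fun g =>
    mul_nonneg (hprob.1 g) (green_nonneg hprob _ _)
  simpa [convPow] using h

/-- Harnack inequality for the Green function along a word. -/
theorem pow_length_mul_green_le (hprob : IsProbMeasure μ) (htr : IsTransient μ) {S : Set G}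
    {ρ : ℝ} (hρ : 0 ≤ ρ) (hS : ∀ s ∈ S, ρ ≤ μ s) (l : List G) (hl : ∀ s ∈ l, s ∈ S) (k x : G) :
    ρ ^ l.length * green μ (k * l.prod) x ≤ green μ k x := by
  induction l generalizing k with
  | nil => simp
  | cons s l ih =>
    simp only [List.mem_cons, forall_eq_or_imp] at hl
    calc ρ ^ (s :: l).length * green μ (k * (s :: l).prod) x
        = ρ * (ρ ^ l.length * green μ (k * s * l.prod) x) := by
          simp [pow_succ', mul_assoc]
      _ ≤ ρ * green μ (k * s) x := by gcongr; exact ih hl.2 (k * s)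
      _ ≤ μ s * green μ (k * s) x := by
          gcongr
          · exact green_nonneg hprob _ _
          · exact hS s hl.1
      _ ≤ green μ k x := mul_green_le_green hprob htr k s x

theorem exists_word_length_eq_wordLength {S : Set G} (hSsym : ∀ s ∈ S, s⁻¹ ∈ S)
    (hSgen : Subgroup.closure S = ⊤) (x : G) :
    ∃ l : List G, l.length = wordLength S x ∧ (∀ s ∈ l, s ∈ S) ∧ l.prod = x := by
  refine Nat.sInf_mem (s := {n : ℕ | ∃ l : List G, l.length = n ∧ (∀ a ∈ l, a ∈ S) ∧ l.prod = x}) ?_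
  have hx : x ∈ (Subgroup.closure S).toSubmonoid := by simp [hSgen]
  rw [Subgroup.closure_toSubmonoid] at hx
  obtain ⟨l, hl, rfl⟩ := Submonoid.exists_list_of_mem_closure hx
  refine ⟨l.length, l, rfl, fun s hs => ?_, rfl⟩
  rcases hl s hs with h | h
  · exact h
  · simpa using hSsym _ h

theorem pow_wordLength_mul_green_le (hprob : IsProbMeasure μ) (htr : IsTransient μ) {S : Set G}
    (hSsym : ∀ s ∈ S, s⁻¹ ∈ S) (hSgen : Subgroup.closure S = ⊤)
    {ρ : ℝ} (hρ : 0 ≤ ρ) (hS : ∀ s ∈ S, ρ ≤ μ s) (k g x : G) :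
    ρ ^ wordLength S g * green μ (k * g) x ≤ green μ k x := by
  obtain ⟨l, hlen, hl, rfl⟩ := exists_word_length_eq_wordLength hSsym hSgen g
  rw [← hlen]
  exact pow_length_mul_green_le hprob htr hρ hS l hl k x

/-- Under strong Liouville, ratios of Green functions tend to `1` at infinity. -/
theorem tendsto_green_div_green_cofinite (hprob : IsProbMeasure μ) (htr : IsTransient μ)
    {S : Set G} (hSsym : ∀ s ∈ S, s⁻¹ ∈ S) (hSgen : Subgroup.closure S = ⊤)
    {ρ : ℝ} (hρ : 0 < ρ) (hS : ∀ s ∈ S, ρ ≤ μ s)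
    (hmom : Summable fun g : G => μ g * (ρ ^ wordLength S g)⁻¹)
    (hSL : ∀ f : G → ℝ, (∀ x, 0 < f x) → IsHarmonic μ f → ∀ x y, f x = f y) (a b : G) :
    Tendsto (fun x => green μ b x / green μ a x) cofinite (𝓝 1) := by
  have harnack := pow_wordLength_mul_green_le hprob htr hSsym hSgen hρ.le hS
  have hpos (y x : G) : 0 < green μ y x := by
    have h := harnack y (y⁻¹ * x) x
    rw [mul_inv_cancel_left] at h
    have := one_le_green_self hprob htr x
    exact lt_of_lt_of_le (by positivity) h
  have hlower (y x : G) : ρ ^ wordLength S (y⁻¹ * a) ≤ green μ y x / green μ a x := by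
    rw [le_div_iff₀ (hpos a x)]
    simpa using harnack y (y⁻¹ * a) x
  have hupper (y x : G) : green μ y x / green μ a x ≤ (ρ ^ wordLength S (a⁻¹ * y))⁻¹ := by
    rw [div_le_iff₀ (hpos a x), ← div_eq_inv_mul, le_div_iff₀' (by positivity)]
    simpa using harnack a (a⁻¹ * y) x
  rw [tendsto_iff_ultrafilter]
  intro U hU
  have hlim (y : G) : ∃ c ∈ Set.Icc (ρ ^ wordLength S (y⁻¹ * a)) (ρ ^ wordLength S (a⁻¹ * y))⁻¹,
      Tendsto (fun x => green μ y x / green μ a x) U (𝓝 c) :=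
    isCompact_Icc.ultrafilter_le_nhds (U.map fun x => green μ y x / green μ a x)
      (le_principal_iff.2 (mem_map.2 (univ_mem' fun x => ⟨hlower y x, hupper y x⟩)))
  choose K hK hKlim using hlim
  have hKpos (y : G) : 0 < K y := lt_of_lt_of_le (by positivity) (hK y).1
  have hbound (k g x : G) : μ g * (green μ (k * g) x / green μ a x) ≤
      μ g * (ρ ^ wordLength S g)⁻¹ * (ρ ^ wordLength S (a⁻¹ * k))⁻¹ := by
    rw [mul_assoc]
    refine mul_le_mul_of_nonneg_left ?_ (hprob.1 g)
    refine le_trans ?_ (mul_le_mul_of_nonneg_left (hupper k x) (by positivity))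
    rw [← mul_div_assoc]
    refine div_le_div_of_nonneg_right ?_ (hpos a x).le
    rw [← div_eq_inv_mul, le_div_iff₀' (by positivity)]
    exact harnack k g x
  have hharm : IsHarmonic μ K := by
    intro k
    have hdom := hmom.mul_right (ρ ^ wordLength S (a⁻¹ * k))⁻¹
    have hterm (g : G) : Tendsto (fun x => μ g * (green μ (k * g) x / green μ a x)) U
        (𝓝 (μ g * K (k * g))) := (hKlim (k * g)).const_mul _
    have hKsum : Summable fun g => μ g * K (k * g) :=
      hdom.of_nonneg_of_le (fun g => mul_nonneg (hprob.1 g) (hKpos _).le)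
        fun g => le_of_tendsto' (hterm g) fun x => hbound k g x
    have htsum : Tendsto (fun x => ∑' g, μ g * (green μ (k * g) x / green μ a x)) U
        (𝓝 (∑' g, μ g * K (k * g))) := by
      refine tendsto_tsum_of_dominated_convergence hdom hterm (Eventually.of_forall fun x g => ?_)
      rw [Real.norm_of_nonneg
        (mul_nonneg (hprob.1 g) (div_nonneg (hpos _ _).le (hpos _ _).le))]
      exact hbound k g x
    have hev : (fun x => ∑' g, μ g * (green μ (k * g) x / green μ a x)) =ᶠ[U]
        fun x => green μ k x / green μ a x := by
      filter_upwards [hU (Set.finite_singleton k).compl_mem_cofinite] with x hx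
      have hxk : k⁻¹ * x ≠ 1 := fun h => hx (inv_mul_eq_one.1 h).symm
      have h := (hasSum_mul_green hprob htr k x).div_const (green μ a x)
      simp only [convPow, hxk, if_false, sub_zero, mul_div_assoc] at h
      exact h.tsum_eq
    rw [← tendsto_nhds_unique (htsum.congr' hev) (hKlim k)]
    exact hKsum.hasSum
  have hKa : K a = 1 := tendsto_nhds_unique (hKlim a)
    (tendsto_const_nhds.congr fun x => (div_self (hpos a x).ne').symm)
  rw [← hKa, hSL K hKpos hharm a b]
  exact hKlim b

end Green

/-- Strong Liouville (plus a mild exponential-moment hypothesis)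
implies `Δ(S_n;a,b) → 0` along every exhaustion. -/
theorem strongLiouville_implies_delta_tendsto_zero
    {G : Type*} [Group G] (μ : G → ℝ)
    (hprob : IsProbMeasure μ) (hsym : IsSymmetricMeasure μ)
    (hnd : IsNonDegenerate μ) (htr : IsTransient μ)
    (S : Finset G) (hSne : S.Nonempty)
    (hSsupp : ∀ s ∈ S, μ s ≠ 0)
    (hSsym : ∀ s ∈ S, s⁻¹ ∈ S)
    (hSgen : Subgroup.closure (S : Set G) = ⊤)
    (ρ₀ : ℝ) (hρ₀pos : 0 < ρ₀) (hρ₀lt : ρ₀ < S.inf' hSne μ)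
    (hmom : Summable fun g : G => μ g * (ρ₀ ^ wordLength (S : Set G) g)⁻¹)
    (hSL : ∀ f : G → ℝ, (∀ x, 0 < f x) → IsHarmonic μ f → ∀ x y, f x = f y) :
    ∀ a b : G, ∀ Sn : ℕ → Finset G, Monotone Sn → (∀ g : G, ∃ n, g ∈ Sn n) →
      Tendsto (fun n => greenDelta μ (S : Set G) (Sn n : Set G) a b) atTop (nhds 0) := by
  intro a b Sn hmono hex
  have hρ (s : G) (hs : s ∈ (S : Set G)) : ρ₀ ≤ μ s := hρ₀lt.le.trans (Finset.inf'_le μ hs)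
  have hquot := tendsto_green_div_green_cofinite hprob htr hSsym hSgen hρ₀pos hρ hmom hSL a b
  have hself := tendsto_green_div_green_cofinite hprob htr hSsym hSgen hρ₀pos hρ hmom hSL a a
  have hnn (x : G) : 0 ≤ |green μ a x - green μ b x| / green μ a x :=
    div_nonneg (abs_nonneg _) (green_nonneg hprob a x)
  have hlim : Tendsto (fun x => |green μ a x - green μ b x| / green μ a x) cofinite (𝓝 0) := by
    have h := (hself.sub hquot).abs
    rw [sub_self, abs_zero] at h
    refine h.congr fun x => ?_
    rw [← sub_div, abs_div, abs_of_nonneg (green_nonneg hprob a x)]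
  rw [Metric.tendsto_atTop]
  intro ε hε
  have hfin := eventually_cofinite.1 (hlim.eventually_lt_const (half_pos hε))
  have hmem : ∀ᶠ n in atTop, ∀ x ∈ {x | ¬ |green μ a x - green μ b x| / green μ a x < ε / 2},
      x ∈ Sn n := by
    rw [eventually_all_finite hfin]
    intro x _
    obtain ⟨n, hn⟩ := hex x
    exact eventually_atTop.2 ⟨n, fun m hm => hmono hm hn⟩
  obtain ⟨N, hN⟩ := eventually_atTop.1 hmem
  refine ⟨N, fun n hn => ?_⟩
  have hle : greenDelta μ (S : Set G) (Sn n : Set G) a b ≤ ε / 2 := by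
    refine Real.sSup_le ?_ (half_pos hε).le
    rintro _ ⟨x, hx, rfl⟩
    by_contra hlt
    exact hx.1 (hN n hn x fun h => hlt h.le)
  have hge : 0 ≤ greenDelta μ (S : Set G) (Sn n : Set G) a b :=
    Real.sSup_nonneg fun _ ⟨x, _, hx⟩ => hx ▸ hnn x
  rw [Real.dist_eq, sub_zero, abs_of_nonneg hge]
  linarith
end
end

section
/- In the graph/kernel setting below, assume A(1) = ∑_{n≥1} Vol(ρ(n))^{-1} < ∞ and that the hypotheses (HK), (OD), (IH), (TR_α) hold for some α ∈ (0,1]. Then there exists a constant C > 0 such that for every finite set S ⊆ 𝔾 and all a,b ∈ 𝔾 \ ∂S with d(a,b) ≤ R(S;a,b), one has Δ(S;a,b) ≤ C (d(a,b)/R(S;a,b))^α. In particular, for each fixed a,b, Δ(S;a,b) → 0 along any exhaustion S ↗ 𝔾. -/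
open Filter Topology

noncomputable section

/- Iterates of a Markov kernel `p` on a countable vertex set:
`kerPow p 0 = δ`, `kerPow p (n+1) x y = ∑_z kerPow p n x z * p z y`. -/
open Classical in
def kerPow {V : Type*} (p : V → V → ℝ) : ℕ → V → V → ℝ
  | 0 => fun x y => if x = y then 1 else 0
  | n + 1 => fun x y => ∑' z : V, kerPow p n x z * p z y

/-- Green function of the kernel `p`. -/
def kGreen {V : Type*} (p : V → V → ℝ) (x y : V) : ℝ :=
  ∑' n : ℕ, kerPow p n x y

/-- Outer vertex boundary of a set `S` in the graph `Gr`. -/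
def vBoundary {V : Type*} (Gr : SimpleGraph V) (S : Set V) : Set V :=
  {x : V | x ∉ S ∧ ∃ y ∈ S, Gr.Adj y x}

/-- Green-variation functional `Δ(S;a,b) = max_{x ∈ ∂S} |G(a,x)−G(b,x)|/G(a,x)`. -/
def kDelta {V : Type*} (Gr : SimpleGraph V) (p : V → V → ℝ) (S : Set V) (a b : V) : ℝ :=
  sSup ((fun x => |kGreen p a x - kGreen p b x| / kGreen p a x) '' vBoundary Gr S)

/-- `R(S;a,b) = dist({a,b}, ∂S)` in the graph metric, as a real number. -/
def kR {V : Type*} (Gr : SimpleGraph V) (S : Set V) (a b : V) : ℝ :=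
  sInf ((fun x => ((min (Gr.dist a x) (Gr.dist b x) : ℕ) : ℝ)) '' vBoundary Gr S)

/-- Near-diagonal threshold `n₋(r) = min {n ≥ 1 : ρ(n) ≥ r/κ}`. -/
def nMinus (ρ : ℕ → ℝ) (κ r : ℝ) : ℕ :=
  sInf {n : ℕ | 1 ≤ n ∧ r / κ ≤ ρ n}

lemma kerPow_nonneg {V : Type*} {p : V → V → ℝ} (hp0 : ∀ x y, 0 ≤ p x y) (n : ℕ) (x y : V) :
    0 ≤ kerPow p n x y := by
  induction n generalizing y with
  | zero => simp only [kerPow]; split_ifs <;> norm_num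
  | succ n ih => exact tsum_nonneg fun z => mul_nonneg (ih z) (hp0 z y)

lemma summable_kerPow {V : Type*} {p : V → V → ℝ} (hp0 : ∀ x y, 0 ≤ p x y)
    (hrow : ∀ x, HasSum (p x) 1) (n : ℕ) (x : V) : Summable (kerPow p n x) := by
  induction n with
  | zero =>
    classical
    refine summable_of_ne_finset_zero (s := {x}) fun y hy => ?_
    simp only [kerPow]
    exact if_neg fun h => hy (by simp [h])
  | succ n ih =>
    have hprod : Summable fun q : V × V => kerPow p n x q.1 * p q.1 q.2 := by
      refine (summable_prod_of_nonneg fun q =>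
        mul_nonneg (kerPow_nonneg hp0 n x q.1) (hp0 q.1 q.2)).2 ⟨fun z => ?_, ?_⟩
      · exact (hrow z).summable.mul_left (kerPow p n x z)
      · simpa [tsum_mul_left, (hrow _).tsum_eq] using ih
    exact hprod.prod_symm.prod

/-- Balls are finite: on a ball the kernel at a large time is bounded below, and it is summable. -/
lemma finite_ball_of_near_diagonal_bound {V : Type*} {Gr : SimpleGraph V} {p : V → V → ℝ}
    (hp0 : ∀ x y, 0 ≤ p x y) (hrow : ∀ x, HasSum (p x) 1)
    {ρ : ℕ → ℝ} (hρpos : ∀ n, 1 ≤ n → 0 < ρ n) (hρtop : Tendsto ρ atTop atTop)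
    {Vol : ℝ → ℝ} (hVpos : ∀ r : ℝ, 0 < r → 0 < Vol r) {κ c₀ : ℝ} (hκ : 0 < κ) (hc₀ : 0 < c₀)
    (hHKl : ∀ n, 1 ≤ n → ∀ x y : V, (Gr.dist x y : ℝ) ≤ κ * ρ n →
      c₀ / Vol (ρ n) ≤ kerPow p n x y) (x : V) (N : ℕ) :
    {y : V | Gr.dist x y ≤ N}.Finite := by
  obtain ⟨n, hn, hn1⟩ :=
    ((hρtop.eventually_ge_atTop ((N : ℝ) / κ)).and (eventually_ge_atTop 1)).exists
  have hpos : 0 < c₀ / Vol (ρ n) := div_pos hc₀ (hVpos _ (hρpos n hn1))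
  have hlt := (summable_kerPow hp0 hrow n x).tendsto_cofinite_zero.eventually_lt_const hpos
  refine (eventually_cofinite.1 hlt).subset fun y (hy : Gr.dist x y ≤ N) => ?_
  refine not_lt.2 (hHKl n hn1 x y ?_)
  have : (Gr.dist x y : ℝ) ≤ N := by exact_mod_cast hy
  have := (div_le_iff₀ hκ).1 hn
  linarith

lemma nMinus_spec {ρ : ℕ → ℝ} (hρtop : Tendsto ρ atTop atTop) (κ r : ℝ) :
    1 ≤ nMinus ρ κ r ∧ r / κ ≤ ρ (nMinus ρ κ r) :=
  Nat.sInf_mem (s := {n : ℕ | 1 ≤ n ∧ r / κ ≤ ρ n})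
    ((eventually_ge_atTop 1).and (hρtop.eventually_ge_atTop (r / κ))).exists

lemma lt_of_lt_nMinus {ρ : ℕ → ℝ} {κ r : ℝ} {n : ℕ} (hn : 1 ≤ n) (hlt : n < nMinus ρ κ r) :
    ρ n < r / κ :=
  not_le.1 fun h => Nat.notMem_of_lt_sInf hlt ⟨hn, h⟩

/-- A local Hölder estimate at scale `s` extends to all pairs of points, because beyond the scale
the trivial bound suffices. -/
lemma abs_sub_le_of_local_holder {V : Type*} {Gr : SimpleGraph V} {u : V → ℝ}
    (hu0 : ∀ z, 0 ≤ u z) {s θ α C_H M : ℝ} (hs : 0 < s) (hθ : 0 < θ) (hα : 0 < α) (hCH : 0 < C_H)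
    {a b : V}
    (hloc : (Gr.dist a b : ℝ) ≤ θ * s →
      |u a - u b| ≤ C_H * ((Gr.dist a b : ℝ) / s) ^ α *
        sSup (u '' {w : V | (Gr.dist a w : ℝ) ≤ θ * s}))
    (hball : ∀ w, (Gr.dist a w : ℝ) ≤ θ * s → u w ≤ M) (hb : u b ≤ M) :
    |u a - u b| ≤ (C_H + θ ^ (-α)) * ((Gr.dist a b : ℝ) / s) ^ α * M := by
  have hM : 0 ≤ M := (hu0 b).trans hb
  have hθα : 0 < θ ^ (-α) := Real.rpow_pos_of_pos hθ _
  have hpow : 0 ≤ ((Gr.dist a b : ℝ) / s) ^ α := by positivity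
  rcases le_or_gt ((Gr.dist a b : ℝ)) (θ * s) with h | h
  · have hsup : sSup (u '' {w : V | (Gr.dist a w : ℝ) ≤ θ * s}) ≤ M :=
      Real.sSup_le (by rintro _ ⟨w, hw, rfl⟩; exact hball w hw) hM
    calc |u a - u b| ≤ C_H * ((Gr.dist a b : ℝ) / s) ^ α * M :=
          (hloc h).trans (by gcongr)
      _ ≤ _ := by gcongr; linarith
  · have ha : u a ≤ M := hball a (by simp; positivity)
    have hone : 1 ≤ θ ^ (-α) * ((Gr.dist a b : ℝ) / s) ^ α := by
      rw [Real.rpow_neg hθ.le, ← Real.inv_rpow hθ.le,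
        ← Real.mul_rpow (by positivity) (by positivity)]
      refine Real.one_le_rpow ?_ hα.le
      rw [inv_mul_eq_div, div_div, one_le_div (by positivity)]
      linarith
    calc |u a - u b| ≤ M := abs_le.2 ⟨by linarith [hu0 a], by linarith [hu0 b]⟩
      _ ≤ (θ ^ (-α) * ((Gr.dist a b : ℝ) / s) ^ α) * M := le_mul_of_one_le_left hM hone
      _ ≤ _ := by gcongr; linarith

/-- An exhaustion eventually contains every finite set. -/
lemma eventually_subset_of_exhaustion {V : Type*} {Sn : ℕ → Finset V} (hmono : Monotone Sn)
    (hex : ∀ v : V, ∃ n, v ∈ Sn n) {F : Set V} (hF : F.Finite) :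
    ∀ᶠ n in atTop, F ⊆ (Sn n : Set V) := by
  refine (hF.eventually_all (p := fun v n => v ∈ Sn n)).2 fun v _ => ?_
  obtain ⟨k, hk⟩ := hex v
  exact (eventually_ge_atTop k).mono fun n hn => hmono hn hk

/-- Under (HK), (OD), (IH) and (TR_α), with `A(1) < ∞`, there is
`C > 0` with `Δ(S;a,b) ≤ C (d(a,b)/R(S;a,b))^α` for all finite `S` and all
`a, b ∉ ∂S` with `d(a,b) ≤ R(S;a,b)`; in particular `Δ → 0` along exhaustions. -/
theorem delta_decay_from_heat_kernel_envelopes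
    {V : Type*} (Gr : SimpleGraph V) (hconn : Gr.Connected)
    (hbdeg : ∃ D : ℕ, ∀ v : V, (Gr.neighborSet v).ncard ≤ D)
    (p : V → V → ℝ)
    (hp0 : ∀ x y, 0 ≤ p x y) (hpsym : ∀ x y, p x y = p y x)
    (hrow : ∀ x, HasSum (p x) 1)
    (hlazy : ∃ ε > 0, ∀ x, ε ≤ p x x)
    (hirr : ∀ x y : V, ∃ n : ℕ, 0 < kerPow p n x y)
    -- intrinsic scale and reference volume
    (ρ : ℕ → ℝ) (hρpos : ∀ n, 1 ≤ n → 0 < ρ n)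
    (hρmono : StrictMonoOn ρ {n : ℕ | 1 ≤ n}) (hρtop : Tendsto ρ atTop atTop)
    (Vol : ℝ → ℝ) (hVpos : ∀ r : ℝ, 0 < r → 0 < Vol r)
    (hVmono : MonotoneOn Vol (Set.Ioi 0))
    (κ : ℝ) (hκ : 0 < κ)
    -- transience: A(1) < ∞
    (hA1 : Summable fun n : ℕ => if 1 ≤ n then (Vol (ρ n))⁻¹ else 0)
    -- (HK)
    (c₀ C₀ : ℝ) (hc₀ : 0 < c₀) (hC₀ : 0 < C₀)
    (hHKu : ∀ n, 1 ≤ n → ∀ x y : V, kerPow p n x y ≤ C₀ / Vol (ρ n))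
    (hHKl : ∀ n, 1 ≤ n → ∀ x y : V, (Gr.dist x y : ℝ) ≤ κ * ρ n →
      c₀ / Vol (ρ n) ≤ kerPow p n x y)
    -- (OD)
    (Φ : ℝ → ℝ) (C_OD : ℝ) (hCOD : 0 < C_OD)
    (hΦanti : AntitoneOn Φ (Set.Ici 0))
    (hΦrange : ∀ t : ℝ, 0 ≤ t → 0 < Φ t ∧ Φ t ≤ 1)
    (hΦ0 : Tendsto Φ atTop (nhds 0))
    (hOD : ∀ n, 1 ≤ n → ∀ x y : V,
      kerPow p n x y ≤ C_OD / Vol (ρ n) * Φ ((Gr.dist x y : ℝ) / ρ n))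
    -- (IH)
    (θ α C_H : ℝ) (hθ : 0 < θ) (hθκ : θ ≤ κ / 4) (hα : 0 < α) (hα1 : α ≤ 1) (hCH : 0 < C_H)
    (hIH : ∀ n, 1 ≤ n → ∀ z₀ y z z' : V,
      (Gr.dist z₀ z : ℝ) ≤ θ * ρ n → (Gr.dist z₀ z' : ℝ) ≤ θ * ρ n →
      |kerPow p n z y - kerPow p n z' y| ≤
        C_H * ((Gr.dist z z' : ℝ) / ρ n) ^ α *
          sSup ((fun w => kerPow p n w y) '' {w : V | (Gr.dist z₀ w : ℝ) ≤ θ * ρ n}))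
    -- (TR_α)
    (C_T : ℝ) (hCT : 0 < C_T)
    (hTR : ∀ r : ℝ, 1 ≤ r →
      (∑' n : ℕ, if 1 ≤ n ∧ n < nMinus ρ κ r then
          (Vol (ρ n))⁻¹ * (ρ n) ^ (-α) * Φ (r / (2 * ρ n)) else 0)
        ≤ C_T * (ρ (nMinus ρ κ r)) ^ (-α) *
            ∑' n : ℕ, if nMinus ρ κ r ≤ n then (Vol (ρ n))⁻¹ else 0) :
    (∃ C > 0, ∀ S : Set V, S.Finite → ∀ a b : V,
        a ∉ vBoundary Gr S → b ∉ vBoundary Gr S →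
        (Gr.dist a b : ℝ) ≤ kR Gr S a b →
        kDelta Gr p S a b ≤ C * ((Gr.dist a b : ℝ) / kR Gr S a b) ^ α) ∧
    (∀ a b : V, ∀ Sn : ℕ → Finset V, Monotone Sn → (∀ v : V, ∃ n, v ∈ Sn n) →
        Tendsto (fun n => kDelta Gr p (Sn n : Set V) a b) atTop (nhds 0)) := by
  have hV : ∀ n, 1 ≤ n → 0 < Vol (ρ n) := fun n hn => hVpos _ (hρpos n hn)
  have hk0 := kerPow_nonneg hp0
  set E : ℝ := C_H + θ ^ (-α) with hE
  have hEpos : 0 < E := add_pos hCH (Real.rpow_pos_of_pos hθ _)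
  set C : ℝ := E * (C_OD * C_T + C₀) * κ ^ α / c₀ with hC
  have hCpos : 0 < C := by positivity
  have hsumG : ∀ x y, Summable fun n => kerPow p n x y := fun x y => by
    refine (summable_nat_add_iff 1).1 <| Summable.of_nonneg_of_le (fun n => hk0 _ _ _) (fun n => ?_)
      (((summable_nat_add_iff 1).2 hA1).mul_left C₀)
    simpa [div_eq_mul_inv] using hHKu (n + 1) (by omega) x y
  have hpoint : ∀ a b x : V, a ≠ x → b ≠ x → Gr.dist a b ≤ Gr.dist b x →
      |kGreen p a x - kGreen p b x| / kGreen p a x ≤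
        C * ((Gr.dist a b : ℝ) / (Gr.dist a x : ℝ)) ^ α := by
    intro a b x hax hbx hab
    have hr1 : (1 : ℝ) ≤ Gr.dist a x := by exact_mod_cast hconn.pos_dist_of_ne hax
    have htri : (Gr.dist a x : ℝ) ≤ 2 * Gr.dist b x := by
      have := hconn.dist_triangle (u := a) (v := b) (w := x)
      exact_mod_cast (by omega : Gr.dist a x ≤ 2 * Gr.dist b x)
    have hTRr := hTR _ hr1
    obtain ⟨hm1, hmr⟩ := nMinus_spec hρtop κ (Gr.dist a x : ℝ)
    have hlt := fun n hn => lt_of_lt_nMinus (ρ := ρ) (κ := κ) (r := (Gr.dist a x : ℝ)) (n := n) hn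
    generalize nMinus ρ κ (Gr.dist a x : ℝ) = m at *
    generalize hr : (Gr.dist a x : ℝ) = r at *
    have hr0 : 0 < r := by linarith
    set F : ℕ → ℝ := fun n => if 1 ≤ n ∧ n < m then
          (Vol (ρ n))⁻¹ * (ρ n) ^ (-α) * Φ (r / (2 * ρ n)) else 0 with hF
    set H : ℕ → ℝ := fun n => if m ≤ n then (Vol (ρ n))⁻¹ else 0 with hH
    set D : ℝ := (Gr.dist a b : ℝ) with hD
    have hD0 : 0 ≤ D := by positivity
    have hH0 : ∀ n, 0 ≤ H n := fun n => by
      simp only [hH]; split_ifs with h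
      · exact (inv_pos.2 (hV n (hm1.trans h))).le
      · exact le_rfl
    have hHs : Summable H := by
      refine Summable.of_nonneg_of_le hH0 (fun n => ?_) hA1
      simp only [hH]; split_ifs with h h' h'
      · exact le_rfl
      · omega
      · exact (inv_pos.2 (hV n h')).le
      · exact le_rfl
    have hFs : Summable F := summable_of_ne_finset_zero (s := Finset.range m) fun n hn =>
      if_neg fun h => hn (Finset.mem_range.2 h.2)
    have hApos : 0 < ∑' n, H n := by
      refine hHs.tsum_pos hH0 m ?_
      simpa [hH] using hV m hm1
    have hρm : 0 < ρ m := hρpos m hm1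
    have hρm0 : 0 ≤ ρ m ^ (-α) := by positivity
    have hDpow : ∀ n, 1 ≤ n → (D / ρ n) ^ α = D ^ α * ρ n ^ (-α) := fun n hn => by
      rw [Real.div_rpow hD0 (hρpos n hn).le, Real.rpow_neg (hρpos n hn).le, div_eq_mul_inv]
    have hterm : ∀ n, |kerPow p n a x - kerPow p n b x| ≤
        E * D ^ α * C_OD * F n + E * D ^ α * C₀ * ρ m ^ (-α) * H n := by
      intro n
      rcases Nat.eq_zero_or_pos n with rfl | hn
      · have hF0 : F 0 = 0 := if_neg (by omega)
        have hH0' : H 0 = 0 := if_neg (by omega)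
        simp [kerPow, hax, hbx, hF0, hH0']
      have hs := hρpos n hn
      have hloc : (Gr.dist a b : ℝ) ≤ θ * ρ n → _ := fun h =>
        hIH n hn a x a b (by simp; positivity) h
      rcases lt_or_ge n m with hnm | hnm
      · have hFn : F n = (Vol (ρ n))⁻¹ * (ρ n) ^ (-α) * Φ (r / (2 * ρ n)) := if_pos ⟨hn, hnm⟩
        have hHn : H n = 0 := if_neg (by omega)
        have hsr : κ * ρ n < r := by
          have := (lt_div_iff₀ hκ).1 (hlt n hn hnm); linarith
        have hfar : ∀ w, r ≤ 2 * Gr.dist w x →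
            kerPow p n w x ≤ C_OD / Vol (ρ n) * Φ (r / (2 * ρ n)) := fun w hw => by
          refine (hOD n hn w x).trans ?_
          have := hV n hn
          gcongr
          refine hΦanti (Set.mem_Ici.2 (by positivity)) (Set.mem_Ici.2 (by positivity)) ?_
          rw [← div_div]
          gcongr
          linarith
        have hball : ∀ w, (Gr.dist a w : ℝ) ≤ θ * ρ n →
            kerPow p n w x ≤ C_OD / Vol (ρ n) * Φ (r / (2 * ρ n)) := fun w hw => by
          refine hfar w ?_
          have h1 : (Gr.dist a x : ℝ) ≤ Gr.dist a w + Gr.dist w x := by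
            exact_mod_cast hconn.dist_triangle
          have h2 : θ * ρ n ≤ κ / 4 * ρ n := by gcongr
          linarith
        have := abs_sub_le_of_local_holder (fun z => hk0 n z x) hs hθ hα hCH hloc hball
          (hfar b htri)
        rw [← hD, ← hE, hDpow n hn] at this
        rw [hFn, hHn]
        refine this.trans (le_of_eq ?_)
        ring
      · have hFn : F n = 0 := if_neg (by omega)
        have hHn : H n = (Vol (ρ n))⁻¹ := if_pos hnm
        have := abs_sub_le_of_local_holder (fun z => hk0 n z x) hs hθ hα hCH hloc
          (fun w _ => hHKu n hn w x) (hHKu n hn b x)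
        rw [← hD, ← hE, hDpow n hn] at this
        have hmono : ρ n ^ (-α) ≤ ρ m ^ (-α) :=
          Real.rpow_le_rpow_of_nonpos hρm (hρmono.monotoneOn hm1 hn hnm) (by linarith)
        have hVn := hV n hn
        rw [hFn, hHn]
        calc _ ≤ _ := this
          _ ≤ E * (D ^ α * ρ m ^ (-α)) * (C₀ / Vol (ρ n)) := by gcongr
          _ = _ := by ring
    have hbs : Summable fun n => E * D ^ α * C_OD * F n + E * D ^ α * C₀ * ρ m ^ (-α) * H n :=
      (hFs.mul_left _).add (hHs.mul_left _)
    have hnum : |kGreen p a x - kGreen p b x| ≤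
        E * (C_OD * C_T + C₀) * D ^ α * ρ m ^ (-α) * ∑' n, H n := by
      rw [kGreen, kGreen, ← (hsumG a x).tsum_sub (hsumG b x)]
      have h1 := tsum_of_norm_bounded
        (f := fun n => kerPow p n a x - kerPow p n b x) hbs.hasSum hterm
      rw [(hFs.mul_left _).tsum_add (hHs.mul_left _), tsum_mul_left, tsum_mul_left] at h1
      have h2 : E * D ^ α * C_OD * ∑' n, F n ≤
          E * D ^ α * C_OD * (C_T * ρ m ^ (-α) * ∑' n, H n) := by gcongr
      rw [Real.norm_eq_abs] at h1
      calc _ ≤ _ := h1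
        _ ≤ _ := add_le_add_left h2 _
        _ = _ := by ring
    have hden : c₀ * ∑' n, H n ≤ kGreen p a x := by
      rw [← tsum_mul_left, kGreen]
      refine (hHs.mul_left _).tsum_le_tsum (fun n => ?_) (hsumG a x)
      simp only [hH]; split_ifs with h
      · rw [← div_eq_mul_inv]
        refine hHKl n (hm1.trans h) a x ?_
        have h1 := (div_le_iff₀ hκ).1 hmr
        have h2 := mul_le_mul_of_nonneg_left (hρmono.monotoneOn hm1 (hm1.trans h) h) hκ.le
        linarith
      · simpa using hk0 n a x
    have hpow : D ^ α * ρ m ^ (-α) ≤ κ ^ α * (D / r) ^ α := by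
      have h1 : ρ m ^ (-α) ≤ (r / κ) ^ (-α) :=
        Real.rpow_le_rpow_of_nonpos (by positivity) hmr (by linarith)
      have h2 : D ^ α * (r / κ) ^ (-α) = κ ^ α * (D / r) ^ α := by
        rw [Real.rpow_neg (by positivity), ← Real.inv_rpow (by positivity),
          ← Real.mul_rpow hD0 (by positivity), ← Real.mul_rpow hκ.le (by positivity)]
        congr 1
        field_simp
      rw [← h2]
      gcongr
    have hG : 0 < kGreen p a x := (mul_pos hc₀ hApos).trans_le hden
    rw [div_le_iff₀ hG]
    calc _ ≤ _ := hnum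
      _ = E * (C_OD * C_T + C₀) * (D ^ α * ρ m ^ (-α)) * ∑' n, H n := by ring
      _ ≤ E * (C_OD * C_T + C₀) * (κ ^ α * (D / r) ^ α) * ∑' n, H n := by gcongr
      _ = C * (D / r) ^ α * (c₀ * ∑' n, H n) := by rw [hC]; field_simp
      _ ≤ _ := by gcongr
  have hbound : ∀ S : Set V, ∀ a b : V, a ∉ vBoundary Gr S → b ∉ vBoundary Gr S →
      ∀ R : ℝ, 0 ≤ R → (Gr.dist a b : ℝ) ≤ R →
      (∀ x ∈ vBoundary Gr S, R ≤ Gr.dist a x ∧ R ≤ Gr.dist b x) →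
      (R = 0 → vBoundary Gr S = ∅) →
      kDelta Gr p S a b ≤ C * ((Gr.dist a b : ℝ) / R) ^ α := by
    intro S a b ha hb R hR hab hx hR0
    refine Real.sSup_le ?_ (by positivity)
    rintro _ ⟨x, hxS, rfl⟩
    have hRpos : 0 < R := hR.lt_of_ne' fun h => by simp [hR0 h] at hxS
    obtain ⟨hRa, hRb⟩ := hx x hxS
    refine (hpoint a b x (fun h => ha (h ▸ hxS)) (fun h => hb (h ▸ hxS)) ?_).trans ?_
    · exact_mod_cast hab.trans hRb
    · gcongr
  refine ⟨⟨C, hCpos, fun S _ a b ha hb hab => ?_⟩, fun a b Sn hmono hex => ?_⟩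
  · refine hbound S a b ha hb _ (le_trans (by positivity) hab) hab (fun x hxS => ?_) fun h0 => ?_
    · have hle : kR Gr S a b ≤ ((min (Gr.dist a x) (Gr.dist b x) : ℕ) : ℝ) :=
        csInf_le ⟨0, by rintro _ ⟨_, _, rfl⟩; positivity⟩ ⟨x, hxS, rfl⟩
      exact ⟨hle.trans (by exact_mod_cast min_le_left _ _),
        hle.trans (by exact_mod_cast min_le_right _ _)⟩
    · by_contra hne
      have hone : 1 ≤ kR Gr S a b := by
        refine le_csInf ((Set.nonempty_iff_ne_empty.2 hne).image _) ?_
        rintro _ ⟨x, hxS, rfl⟩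
        have h1 := hconn.pos_dist_of_ne (fun h => ha (h ▸ hxS) : a ≠ x)
        have h2 := hconn.pos_dist_of_ne (fun h => hb (h ▸ hxS) : b ≠ x)
        exact Nat.one_le_cast.2 (le_min h1 h2)
      linarith
  · have hfin := finite_ball_of_near_diagonal_bound hp0 hrow hρpos hρtop hVpos hκ hc₀ hHKl
    have hnonneg : ∀ S, 0 ≤ kDelta Gr p S a b := fun S => by
      refine Real.sSup_nonneg ?_
      rintro _ ⟨x, _, rfl⟩
      exact div_nonneg (abs_nonneg _) (tsum_nonneg fun n => hk0 n a x)
    have hlim : Tendsto (fun N : ℕ => C * ((Gr.dist a b : ℝ) / N) ^ α) atTop (𝓝 0) := by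
      have h := ((tendsto_const_div_atTop_nhds_zero_nat (Gr.dist a b : ℝ)).rpow_const
        (Or.inr hα.le)).const_mul C
      simpa [Real.zero_rpow hα.ne'] using h
    refine tendsto_order.2 ⟨fun y hy => Eventually.of_forall fun n => hy.trans_le (hnonneg _),
      fun ε hε => ?_⟩
    obtain ⟨N, hNε, hN⟩ := ((hlim.eventually_lt_const hε).and
      (eventually_ge_atTop (Gr.dist a b + 1))).exists
    filter_upwards [eventually_subset_of_exhaustion hmono hex ((hfin a N).union (hfin b N))]
      with n hn
    refine (hbound _ a b (fun h => h.1 (hn (Or.inl (by simp))))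
      (fun h => h.1 (hn (Or.inr (by simp)))) N (by positivity)
      (by exact_mod_cast (by omega : Gr.dist a b ≤ N)) (fun x hxS => ?_)
      (fun h => ?_)).trans_lt hNε
    · constructor
      · by_contra! h
        exact hxS.1 (hn (Or.inl (by exact_mod_cast h.le)))
      · by_contra! h
        exact hxS.1 (hn (Or.inr (by exact_mod_cast h.le)))
    · have : N = 0 := by exact_mod_cast h
      omega
end
end

section
/- Let G be a finitely generated group with finite symmetric generating set S, and let μ be a symmetric, non-degenerate probability measure on G generating a transient random walk. Assume the Martin boundary is trivial in the following sense: for every x ∈ G and every ε > 0 there exists a finite set F ⊆ G such that |G(x,y)/G(e,y) − 1| ≤ ε for all y ∉ F. Define the Green distance d_G(e,x) := log G(e,e) − log G(e,x). Then: (i) lim_{r→∞} sup_{|x|=r} d_G(e,x)/r = 0; and (ii) for every sequence (g_n) in G such that |g_n|/n converges to a finite limit as n → ∞, one has d_G(e,g_n)/n → 0. -/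
open Filter Topology

noncomputable section

/-- Green distance `d_G(e,x) = log G(e,e) − log G(e,x)`. -/
def greenDist {G : Type*} [Group G] (μ : G → ℝ) (x : G) : ℝ :=
  Real.log (green μ 1 1) - Real.log (green μ 1 x)

lemma green_eq_green_one {G : Type*} [Group G] (μ : G → ℝ) (x y : G) :
    green μ x y = green μ 1 (x⁻¹ * y) := by
  simp [green]

/-- If the Martin kernels converge to `1` at infinity, then left translation by a fixed element
changes the Green distance by at most `ε` outside a finite set. -/
lemma exists_finset_abs_greenDist_sub_le {G : Type*} [Group G] (μ : G → ℝ)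
    (hMartin : ∀ x : G, ∀ ε > (0:ℝ), ∃ F : Finset G, ∀ y : G, y ∉ F →
      |green μ x y / green μ 1 y - 1| ≤ ε) (s : G) {ε : ℝ} (hε : 0 < ε) :
    ∃ F : Finset G, ∀ y : G, y ∉ F → |greenDist μ y - greenDist μ (s⁻¹ * y)| ≤ ε := by
  have hlog : ∀ᶠ t : ℝ in 𝓝 1, |Real.log t| < ε := by
    have h := (Real.continuousAt_log one_ne_zero).abs.tendsto
    rw [Real.log_one, abs_zero] at h
    exact h.eventually_lt_const hε
  obtain ⟨δ, hδ, hball⟩ := Metric.eventually_nhds_iff.1 hlog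
  obtain ⟨F, hF⟩ := hMartin s (min (δ / 2) (1 / 2)) (by positivity)
  refine ⟨F, fun y hy => ?_⟩
  have hclose := hF y hy
  have hratio : green μ s y / green μ 1 y ≠ 0 := by
    intro h
    rw [h] at hclose
    have := hclose.trans (min_le_right _ _)
    norm_num at this
  obtain ⟨hs, h1⟩ := div_ne_zero_iff.1 hratio
  have hle := (hball (y := green μ s y / green μ 1 y) (by
    rw [Real.dist_eq]
    linarith [min_le_left (δ / 2) (1 / 2)])).le
  rw [Real.log_div hs h1, green_eq_green_one μ s y] at hle
  rwa [greenDist, greenDist, sub_sub_sub_cancel_left]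

/-- If left translation by each element of a finite set `S` changes `f` by at most `ε` outside a
finite set, then `f` grows at rate at most `ε` along products of elements of `S`. -/
lemma exists_abs_list_prod_le {G : Type*} [Group G] (S : Finset G) (f : G → ℝ) {ε : ℝ}
    (hε : 0 ≤ ε)
    (hf : ∀ s : G, ∃ F : Finset G, ∀ y : G, y ∉ F → |f y - f (s⁻¹ * y)| ≤ ε) :
    ∃ M : ℝ, ∀ l : List G, (∀ a ∈ l, a ∈ S) → |f l.prod| ≤ ε * l.length + M := by
  classical
  choose F hF using hf
  refine ⟨|f 1| + ∑ y ∈ S.biUnion F, |f y|, fun l => ?_⟩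
  have hsum : 0 ≤ ∑ y ∈ S.biUnion F, |f y| := Finset.sum_nonneg fun _ _ => abs_nonneg _
  induction l with
  | nil => intro _; simpa using hsum
  | cons a l ih =>
    intro hl
    have ih := ih fun b hb => hl b (List.mem_cons_of_mem _ hb)
    have ha : a ∈ S := hl a List.mem_cons_self
    by_cases hx : (a :: l).prod ∈ S.biUnion F
    · have := Finset.single_le_sum (f := fun y => |f y|) (fun _ _ => abs_nonneg _) hx
      have : 0 ≤ ε * ((a :: l).length : ℝ) := by positivity
      linarith [abs_nonneg (f 1)]
    · have hstep := hF a _ fun h => hx (Finset.mem_biUnion.2 ⟨a, ha, h⟩)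
      rw [List.prod_cons, inv_mul_cancel_left] at hstep
      have := abs_sub_abs_le_abs_sub (f (a * l.prod)) (f l.prod)
      rw [List.prod_cons, List.length_cons]
      push_cast
      linarith

/-- Word length with respect to a symmetric generating set is attained by a word. -/
lemma exists_list_length_eq_wordLength {G : Type*} [Group G] {S : Set G}
    (hSsym : ∀ s ∈ S, s⁻¹ ∈ S) (hSgen : Subgroup.closure S = ⊤) (x : G) :
    ∃ l : List G, l.length = wordLength S x ∧ (∀ a ∈ l, a ∈ S) ∧ l.prod = x := by
  refine Nat.sInf_mem (s := {n | ∃ l : List G, l.length = n ∧ (∀ a ∈ l, a ∈ S) ∧ l.prod = x}) ?_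
  have hx : x ∈ (Subgroup.closure S).toSubmonoid := by simp [hSgen]
  rw [Subgroup.closure_toSubmonoid] at hx
  obtain ⟨l, hl, hprod⟩ := Submonoid.exists_list_of_mem_closure hx
  exact ⟨l.length, l, rfl, fun a ha => (hl a ha).elim id fun h => by simpa using hSsym _ h, hprod⟩

lemma abs_sSup_le {A : Set ℝ} {ε : ℝ} (hε : 0 ≤ ε) (hA : ∀ a ∈ A, |a| ≤ ε) : |sSup A| ≤ ε := by
  rcases A.eq_empty_or_nonempty with rfl | ⟨a, ha⟩
  · simpa using hε
  · have hub : ∀ b ∈ A, b ≤ ε := fun b hb => (abs_le.1 (hA b hb)).2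
    exact abs_le.2 ⟨(abs_le.1 (hA a ha)).1.trans (le_csSup ⟨ε, hub⟩ ha), csSup_le ⟨a, ha⟩ hub⟩

/-- Trivial Martin boundary forces linear-scale collapse of the
Green metric and vanishing Green speed along sequences of finite word speed. -/
theorem green_geometry_collapse_of_trivial_martin_boundary
    {G : Type*} [Group G] (μ : G → ℝ)
    (S : Finset G) (hSsym : ∀ s ∈ S, s⁻¹ ∈ S)
    (hSgen : Subgroup.closure (S : Set G) = ⊤)
    (hprob : IsProbMeasure μ) (hsym : IsSymmetricMeasure μ) (hnd : IsNonDegenerate μ)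
    (htr : IsTransient μ)
    -- trivial Martin boundary: the Martin kernels converge to 1 at infinity
    (hMartin : ∀ x : G, ∀ ε > (0:ℝ), ∃ F : Finset G, ∀ y : G, y ∉ F →
      |green μ x y / green μ 1 y - 1| ≤ ε) :
    Tendsto (fun r : ℕ =>
        sSup ((fun x => greenDist μ x / (r : ℝ)) '' {x : G | wordLength (S : Set G) x = r}))
      atTop (nhds 0) ∧
    ∀ g : ℕ → G, ∀ v : ℝ,
      Tendsto (fun n => (wordLength (S : Set G) (g n) : ℝ) / (n : ℝ)) atTop (nhds v) →
      Tendsto (fun n => greenDist μ (g n) / (n : ℝ)) atTop (nhds 0) := by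
  have hbound : ∀ ε > (0:ℝ), ∃ M : ℝ, ∀ x : G,
      |greenDist μ x| ≤ ε * wordLength (S : Set G) x + M := by
    intro ε hε
    obtain ⟨M, hM⟩ := exists_abs_list_prod_le S (greenDist μ) hε.le fun s =>
      exists_finset_abs_greenDist_sub_le μ hMartin s hε
    refine ⟨M, fun x => ?_⟩
    obtain ⟨l, hlen, hl, rfl⟩ := exists_list_length_eq_wordLength hSsym hSgen x
    rw [← hlen]
    exact hM l hl
  have hMdiv : ∀ M : ℝ, ∀ ε > (0:ℝ), ∀ᶠ n : ℕ in atTop, M / (n : ℝ) < ε := fun M ε hε =>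
    (tendsto_const_div_atTop_nhds_zero_nat M).eventually_lt_const hε
  constructor
  · rw [Metric.tendsto_nhds]
    intro ε hε
    obtain ⟨M, hM⟩ := hbound (ε / 4) (by positivity)
    filter_upwards [hMdiv M (ε / 4) (by positivity), eventually_gt_atTop 0] with r hr hr0
    have hr0' : (0:ℝ) < r := by exact_mod_cast hr0
    rw [Real.dist_eq, sub_zero]
    refine (abs_sSup_le (half_pos hε).le ?_).trans_lt (half_lt_self hε)
    rintro _ ⟨x, hx, rfl⟩
    have hx' := hM x
    rw [show wordLength (S : Set G) x = r from hx] at hx'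
    rw [div_lt_iff₀ hr0'] at hr
    rw [abs_div, abs_of_pos hr0', div_le_iff₀ hr0']
    linarith
  · intro g v hv
    rw [Metric.tendsto_nhds]
    intro ε hε
    obtain ⟨M, hM⟩ := hbound (ε / (2 * (|v| + 1))) (by positivity)
    filter_upwards [hMdiv M (ε / 2) (by positivity), eventually_gt_atTop 0,
      hv.eventually_lt_const ((le_abs_self v).trans_lt (lt_add_one _))] with n hn hn0 hvn
    have hn0' : (0:ℝ) < n := by exact_mod_cast hn0
    rw [Real.dist_eq, sub_zero, abs_div, abs_of_pos hn0']
    calc |greenDist μ (g n)| / (n : ℝ)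
        ≤ (ε / (2 * (|v| + 1)) * wordLength (S : Set G) (g n) + M) / n := by
          gcongr
          exact hM _
      _ = ε / (2 * (|v| + 1)) * (wordLength (S : Set G) (g n) / n) + M / n := by ring
      _ < ε / (2 * (|v| + 1)) * (|v| + 1) + ε / 2 := by gcongr
      _ = ε := by
          field_simp
          norm_num
end
end

section
/- Let μ be a finitely supported, symmetric, non-degenerate probability measure on a finitely generated group G, and let ψ be a growth gauge. If there exists a non-constant minimal positive μ-harmonic function h whose growth is at least ψ (respectively, at most ψ), then there exist infinitely many pairwise distinct normalised minimal positive μ-harmonic functions whose growth is at least ψ (respectively, at most ψ). -/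
open Filter Topology

noncomputable section

/-- `h` is a minimal positive `μ`-harmonic function. -/
def IsMinimalHarmonic {G : Type*} [Group G] (μ : G → ℝ) (h : G → ℝ) : Prop :=
  (∀ x, 0 < h x) ∧ IsHarmonic μ h ∧
    ∀ u : G → ℝ, (∀ x, 0 < u x) → IsHarmonic μ u → (∀ x, u x ≤ h x) →
      ∃ c > (0:ℝ), ∀ x, u x = c * h x
/-- A growth gauge: positive, non-decreasing, translation stable. -/
def GrowthGauge (ψ : ℕ → ℝ) : Prop :=
  (∀ r, 0 < ψ r) ∧ Monotone ψ ∧ ∀ c : ℕ, ∃ K : ℝ, 1 ≤ K ∧ ∀ r, ψ (r + c) ≤ K * ψ r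

/-- `f` has lower growth at least `ψ`: `sup_{|x|≤r} |f(x)| ≳ ψ(r)` for large `r`. -/
def LowerGrowthGe {G : Type*} [Group G] (S : Set G) (ψ : ℕ → ℝ) (f : G → ℝ) : Prop :=
  ∃ c > (0:ℝ), ∃ R : ℕ, ∀ r : ℕ, R ≤ r →
    c * ψ r ≤ sSup ((fun x => |f x|) '' {x : G | wordLength S x ≤ r})

/-- `f` has upper growth at most `ψ`: `|f(x)| ≲ ψ(|x|)` for large `|x|`. -/
def UpperGrowthLe {G : Type*} [Group G] (S : Set G) (ψ : ℕ → ℝ) (f : G → ℝ) : Prop :=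
  ∃ C > (0:ℝ), ∃ R : ℕ, ∀ x : G, R ≤ wordLength S x → |f x| ≤ C * ψ (wordLength S x)

section WordLength

variable {G : Type*} [Group G] {S : Set G}

theorem exists_list_prod_eq (hSsym : ∀ s ∈ S, s⁻¹ ∈ S) (hSgen : Subgroup.closure S = ⊤) (x : G) :
    ∃ l : List G, l.length = wordLength S x ∧ (∀ a ∈ l, a ∈ S) ∧ l.prod = x := by
  have hne : {n : ℕ | ∃ l : List G, l.length = n ∧ (∀ a ∈ l, a ∈ S) ∧ l.prod = x}.Nonempty := by
    have hmem : x ∈ (Subgroup.closure S).toSubmonoid := by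
      rw [hSgen]
      trivial
    rw [Subgroup.closure_toSubmonoid] at hmem
    obtain ⟨l, hl, hx⟩ := Submonoid.exists_list_of_mem_closure hmem
    refine ⟨l.length, l, rfl, fun a ha => ?_, hx⟩
    rcases hl a ha with h | h
    · exact h
    · simpa using hSsym _ h
  exact Nat.sInf_mem hne

theorem wordLength_le_of_list {l : List G} (hl : ∀ a ∈ l, a ∈ S) :
    wordLength S l.prod ≤ l.length :=
  Nat.sInf_le ⟨l, rfl, hl, rfl⟩

theorem wordLength_one : wordLength S (1 : G) = 0 :=
  Nat.le_zero.mp (wordLength_le_of_list (l := []) (by simp))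

theorem wordLength_mul_le (hSsym : ∀ s ∈ S, s⁻¹ ∈ S) (hSgen : Subgroup.closure S = ⊤) (x y : G) :
    wordLength S (x * y) ≤ wordLength S x + wordLength S y := by
  obtain ⟨l, hl, hlS, rfl⟩ := exists_list_prod_eq hSsym hSgen x
  obtain ⟨m, hm, hmS, rfl⟩ := exists_list_prod_eq hSsym hSgen y
  rw [← hl, ← hm, ← List.prod_append, ← List.length_append]
  exact wordLength_le_of_list fun a ha => (List.mem_append.mp ha).elim (hlS a) (hmS a)

theorem finite_wordLength_le (hS : S.Finite) (hSsym : ∀ s ∈ S, s⁻¹ ∈ S)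
    (hSgen : Subgroup.closure S = ⊤) (r : ℕ) : {x : G | wordLength S x ≤ r}.Finite := by
  have := hS.to_subtype
  refine ((List.finite_length_le S r).image fun l => (l.map Subtype.val).prod).subset ?_
  intro x hx
  obtain ⟨l, hl, hlS, hprod⟩ := exists_list_prod_eq hSsym hSgen x
  lift l to List S using hlS
  rw [List.length_map] at hl
  exact ⟨l, hl.trans_le hx, hprod⟩

end WordLength

section Translate

variable {G : Type*} [Group G] {μ : G → ℝ}

/-- The left translate `x ↦ h (y x)`, normalised to be `1` at the identity. -/
def normTranslate (h : G → ℝ) (y : G) : G → ℝ := fun x => h (y * x) / h y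

theorem IsHarmonic.translate_mul {f : G → ℝ} (hf : IsHarmonic μ f) (y : G) (c : ℝ) :
    IsHarmonic μ fun x => c * f (y * x) := by
  intro k
  simpa only [mul_assoc, mul_left_comm c] using (hf (y * k)).mul_left c

theorem normTranslate_one {h : G → ℝ} (hpos : ∀ x, 0 < h x) (y : G) :
    normTranslate h y 1 = 1 := by
  simp [normTranslate, (hpos y).ne']

theorem normTranslate_pos {h : G → ℝ} (hpos : ∀ x, 0 < h x) (y x : G) :
    0 < normTranslate h y x :=
  div_pos (hpos _) (hpos _)

theorem IsHarmonic.normTranslate {h : G → ℝ} (hh : IsHarmonic μ h) (y : G) :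
    IsHarmonic μ (normTranslate h y) := by
  convert hh.translate_mul y (h y)⁻¹ using 2
  rw [_root_.normTranslate, div_eq_inv_mul]

theorem IsMinimalHarmonic.normTranslate {h : G → ℝ} (hh : IsMinimalHarmonic μ h) (y : G) :
    IsMinimalHarmonic μ (normTranslate h y) := by
  obtain ⟨hpos, hharm, hmin⟩ := hh
  refine ⟨normTranslate_pos hpos y, hharm.normTranslate y, fun u hu huh hle => ?_⟩
  obtain ⟨c, hc, huc⟩ := hmin (fun x => h y * u (y⁻¹ * x)) (fun x => mul_pos (hpos y) (hu _))
    (huh.translate_mul y⁻¹ (h y)) (fun x => by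
      have := hle (y⁻¹ * x)
      rw [_root_.normTranslate, mul_inv_cancel_left, le_div_iff₀ (hpos y)] at this
      linarith)
  refine ⟨c, hc, fun x => ?_⟩
  have := huc (y * x)
  rw [inv_mul_cancel_left] at this
  rw [_root_.normTranslate, ← mul_div_assoc, ← this, mul_div_cancel_left₀ _ (hpos y).ne']

theorem normTranslate_normTranslate {h : G → ℝ} (hpos : ∀ x, 0 < h x) (y g : G) :
    normTranslate (normTranslate h y) g = normTranslate h (y * g) := by
  funext x
  simp only [normTranslate, mul_assoc]
  exact div_div_div_cancel_right₀ (hpos y).ne' _ _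

variable {S : Set G} {ψ : ℕ → ℝ} {h : G → ℝ}

theorem UpperGrowthLe.normTranslate (hSsym : ∀ s ∈ S, s⁻¹ ∈ S)
    (hSgen : Subgroup.closure S = ⊤) (hψ : GrowthGauge ψ) (hpos : ∀ x, 0 < h x)
    (hh : UpperGrowthLe S ψ h) (y : G) : UpperGrowthLe S ψ (normTranslate h y) := by
  obtain ⟨C, hC, R, hR⟩ := hh
  obtain ⟨-, hmono, htrans⟩ := hψ
  obtain ⟨K, hK, hψK⟩ := htrans (wordLength S y)
  refine ⟨C * K / h y, div_pos (mul_pos hC (by linarith)) (hpos y),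
    R + wordLength S y⁻¹, fun x hx => ?_⟩
  have hlow := wordLength_mul_le hSsym hSgen y⁻¹ (y * x)
  rw [inv_mul_cancel_left] at hlow
  have hup := wordLength_mul_le hSsym hSgen y x
  have hle : |h (y * x)| ≤ C * (K * ψ (wordLength S x)) :=
    (hR (y * x) (by omega)).trans (mul_le_mul_of_nonneg_left
      ((hmono (by omega : _ ≤ wordLength S x + wordLength S y)).trans (hψK _)) hC.le)
  rw [_root_.normTranslate, abs_div, abs_of_pos (hpos y), div_mul_eq_mul_div, mul_assoc]
  exact div_le_div_of_nonneg_right hle (hpos y).le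

theorem LowerGrowthGe.normTranslate (hS : S.Finite) (hSsym : ∀ s ∈ S, s⁻¹ ∈ S)
    (hSgen : Subgroup.closure S = ⊤) (hψ : GrowthGauge ψ) (hpos : ∀ x, 0 < h x)
    (hh : LowerGrowthGe S ψ h) (y : G) : LowerGrowthGe S ψ (normTranslate h y) := by
  obtain ⟨c, hc, R, hR⟩ := hh
  obtain ⟨-, -, htrans⟩ := hψ
  obtain ⟨K, hK, hψK⟩ := htrans (wordLength S y⁻¹)
  have hK0 : 0 < K := by linarith
  refine ⟨c / K / h y, div_pos (div_pos hc hK0) (hpos y), R + wordLength S y⁻¹, fun r hr => ?_⟩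
  obtain ⟨q, rfl⟩ : ∃ q, r = q + wordLength S y⁻¹ := ⟨r - wordLength S y⁻¹, by omega⟩
  have hsup : c * ψ q ≤ h y * sSup ((fun x => |_root_.normTranslate h y x|) ''
      {x : G | wordLength S x ≤ q + wordLength S y⁻¹}) := by
    refine (hR q (by omega)).trans (csSup_le ⟨_, 1, by simp [wordLength_one], rfl⟩ ?_)
    rintro _ ⟨z, hz, rfl⟩
    have hmem : wordLength S (y⁻¹ * z) ≤ q + wordLength S y⁻¹ := by
      have := wordLength_mul_le hSsym hSgen y⁻¹ z
      have : wordLength S z ≤ q := hz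
      omega
    have hle := le_csSup ((finite_wordLength_le hS hSsym hSgen _).image
      (fun x => |_root_.normTranslate h y x|)).bddAbove ⟨y⁻¹ * z, hmem, rfl⟩
    have heq : |h z| = h y * |_root_.normTranslate h y (y⁻¹ * z)| := by
      rw [_root_.normTranslate, mul_inv_cancel_left, abs_div, abs_of_pos (hpos y),
        mul_div_cancel₀ _ (hpos y).ne']
    exact heq.trans_le (mul_le_mul_of_nonneg_left hle (hpos y).le)
  have hψle : c / K * ψ (q + wordLength S y⁻¹) ≤ c * ψ q := by
    rw [div_mul_eq_mul_div, div_le_iff₀ hK0]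
    nlinarith [mul_le_mul_of_nonneg_left (hψK q) hc.le]
  rw [div_mul_eq_mul_div, div_le_iff₀ (hpos y)]
  linarith

/-- For a symmetric measure, a positive harmonic function with finitely many normalised
translates is constant: averaging `u g + (u g)⁻¹` over the finite orbit gives the value `2`. -/
theorem IsHarmonic.const_of_finite_normTranslate (hprob : IsProbMeasure μ)
    (hsym : IsSymmetricMeasure μ) (hnd : IsNonDegenerate μ) (hpos : ∀ x, 0 < h x)
    (hh : IsHarmonic μ h) (hfin : (Set.range (_root_.normTranslate h)).Finite) (x y : G) :
    h x = h y := by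
  classical
  set O : Finset (G → ℝ) := hfin.toFinset with hO
  have memO : ∀ {u}, u ∈ O ↔ ∃ z, _root_.normTranslate h z = u := by simp [hO]
  have hupos : ∀ u ∈ O, ∀ g, 0 < u g := by
    intro u hu g
    obtain ⟨z, rfl⟩ := memO.mp hu
    exact normTranslate_pos hpos z g
  have htr : ∀ g, ∀ u ∈ O, _root_.normTranslate u g ∈ O := by
    intro g u hu
    obtain ⟨z, rfl⟩ := memO.mp hu
    exact memO.mpr ⟨z * g, (normTranslate_normTranslate hpos z g).symm⟩
  have hinv : ∀ g, ∀ u ∈ O, _root_.normTranslate (_root_.normTranslate u g) g⁻¹ = u := by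
    intro g u hu
    obtain ⟨z, rfl⟩ := memO.mp hu
    simp only [normTranslate_normTranslate hpos, mul_inv_cancel_right]
  have hone : ∀ u ∈ O, u 1 = 1 := by
    intro u hu
    obtain ⟨z, rfl⟩ := memO.mp hu
    exact normTranslate_one hpos z
  have hswap : ∀ g, ∑ u ∈ O, u g⁻¹ = ∑ u ∈ O, (u g)⁻¹ := by
    intro g
    refine Finset.sum_bij' (fun u _ => _root_.normTranslate u g⁻¹)
      (fun u _ => _root_.normTranslate u g) (fun u hu => htr _ u hu) (fun u hu => htr _ u hu)
      (fun u hu => by simpa using hinv g⁻¹ u hu) (fun u hu => hinv g u hu) fun u hu => ?_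
    simp [_root_.normTranslate, hone u hu]
  have hsum : HasSum (fun g => μ g * ∑ u ∈ O, u g) (O.card : ℝ) := by
    have : ∀ u ∈ O, HasSum (fun g => μ g * u g) 1 := by
      intro u hu
      obtain ⟨z, rfl⟩ := memO.mp hu
      simpa [normTranslate_one hpos z] using hh.normTranslate z 1
    simpa [Finset.mul_sum] using hasSum_sum this
  have hsum_inv : HasSum (fun g => μ g * ∑ u ∈ O, (u g)⁻¹) (O.card : ℝ) := by
    convert (Equiv.inv G).hasSum_iff.mpr hsum using 2 with g
    simp [← hsym g, hswap]
  have hzero : HasSum (fun g => μ g * ∑ u ∈ O, (u g + (u g)⁻¹ - 2)) 0 := by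
    have hdiff := (hsum.add hsum_inv).sub (hprob.2.mul_right (2 * (O.card : ℝ)))
    rw [one_mul, two_mul, sub_self] at hdiff
    refine hdiff.congr_fun fun g => ?_
    simp only [Finset.sum_sub_distrib, Finset.sum_add_distrib, Finset.sum_const, nsmul_eq_mul]
    ring
  have hterm : ∀ g, ∀ u ∈ O, u g + (u g)⁻¹ - 2 = (u g - 1) ^ 2 / u g := by
    intro g u hu
    have := (hupos u hu g).ne'
    field_simp
    ring
  have hterm_nonneg : ∀ g, ∀ u ∈ O, 0 ≤ u g + (u g)⁻¹ - 2 := fun g u hu => by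
    rw [hterm g u hu]
    exact div_nonneg (sq_nonneg _) (hupos u hu g).le
  have hvanish := (hasSum_zero_iff_of_nonneg fun g =>
    mul_nonneg (hprob.1 g) (Finset.sum_nonneg (hterm_nonneg g))).mp hzero
  have hstep : ∀ g, μ g ≠ 0 → ∀ z, h (z * g) = h z := by
    intro g hg z
    have hu : _root_.normTranslate h z ∈ O := memO.mpr ⟨z, rfl⟩
    have h0 := (Finset.sum_eq_zero_iff_of_nonneg (hterm_nonneg g)).mp
      ((mul_eq_zero.mp (congrFun hvanish g)).resolve_left hg) _ hu
    rw [hterm g _ hu, div_eq_zero_iff, or_iff_left (hupos _ hu g).ne', sq_eq_zero_iff,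
      sub_eq_zero] at h0
    exact (div_eq_one_iff_eq (hpos z).ne').mp h0
  have hinvariant : ∀ g z, h (z * g) = h z := by
    intro g
    have hg : g ∈ Subsemigroup.closure {g : G | μ g ≠ 0} := by
      rw [show Subsemigroup.closure {g : G | μ g ≠ 0} = ⊤ from hnd]
      trivial
    induction hg using Subsemigroup.closure_induction with
    | mem g hg => exact hstep g hg
    | mul a b _ _ ha hb => exact fun z => by rw [← mul_assoc, hb, ha]
  simpa using (hinvariant (x⁻¹ * y) x).symm

end Translate

/-- Abundance at prescribed growth: a single non-constant minimal
harmonic function with growth at least (resp. at most) `ψ` forces infinitely many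
normalised minimal harmonic functions with the same growth constraint. -/
theorem abundance_at_prescribed_growth
    {G : Type*} [Group G] (μ : G → ℝ)
    (S : Finset G) (hSsym : ∀ s ∈ S, s⁻¹ ∈ S)
    (hSgen : Subgroup.closure (S : Set G) = ⊤)
    (hprob : IsProbMeasure μ) (hsym : IsSymmetricMeasure μ) (hnd : IsNonDegenerate μ)
    (hfin : (Function.support μ).Finite)
    (ψ : ℕ → ℝ) (hψ : GrowthGauge ψ) :
    ((∃ h : G → ℝ, IsMinimalHarmonic μ h ∧ (¬ ∀ x y : G, h x = h y) ∧
        LowerGrowthGe (S : Set G) ψ h) →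
      {h : G → ℝ | IsMinimalHarmonic μ h ∧ h 1 = 1 ∧
        LowerGrowthGe (S : Set G) ψ h}.Infinite) ∧
    ((∃ h : G → ℝ, IsMinimalHarmonic μ h ∧ (¬ ∀ x y : G, h x = h y) ∧
        UpperGrowthLe (S : Set G) ψ h) →
      {h : G → ℝ | IsMinimalHarmonic μ h ∧ h 1 = 1 ∧
        UpperGrowthLe (S : Set G) ψ h}.Infinite) := by
  have hinf : ∀ h : G → ℝ, IsMinimalHarmonic μ h → (¬ ∀ x y : G, h x = h y) →
      (Set.range (normTranslate h)).Infinite := fun h hh hconst hfinite =>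
    hconst (hh.2.1.const_of_finite_normTranslate hprob hsym hnd hh.1 hfinite)
  constructor
  · rintro ⟨h, hh, hconst, hgrow⟩
    refine (hinf h hh hconst).mono ?_
    rintro _ ⟨y, rfl⟩
    exact ⟨hh.normTranslate y, normTranslate_one hh.1 y,
      hgrow.normTranslate S.finite_toSet hSsym hSgen hψ hh.1 y⟩
  · rintro ⟨h, hh, hconst, hgrow⟩
    refine (hinf h hh hconst).mono ?_
    rintro _ ⟨y, rfl⟩
    exact ⟨hh.normTranslate y, normTranslate_one hh.1 y,
      hgrow.normTranslate hSsym hSgen hψ hh.1 y⟩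
end
end

section
/- Let G be a finitely generated nilpotent group of nilpotency class at most 2 (so that the commutator subgroup [G,G] is contained in the centre Z(G)), and let μ be a symmetric, non-degenerate probability measure on G satisfying the dispersion property along the centre: for every z ∈ Z(G), ‖μ^(n) − μ^(n)∗δ_z‖_TV → 0 as n → ∞. Then every bounded μ-harmonic function h on G satisfies h(gz) = h(g) for all g ∈ G and all z ∈ [G,G]; consequently h factors as h = h^{ab} ∘ π through the abelianisation π : G → G/[G,G], and the induced bounded function h^{ab} is harmonic for the pushforward measure π_∗μ. -/
open Filter Topology

noncomputable section

/-- Total variation distance `‖ν₁ − ν₂‖_TV = (1/2) ∑_g |ν₁(g) − ν₂(g)|`. -/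
def tvDist {G : Type*} (ν₁ ν₂ : G → ℝ) : ℝ :=
  (1 / 2) * ∑' g : G, |ν₁ g - ν₂ g|

/- Pushforward of `μ` to the abelianisation: `π_*μ(q) = ∑_{g : π(g) = q} μ(g)`. -/
open Classical in
def abelianizationPush {G : Type*} [Group G] (μ : G → ℝ) (q : Abelianization G) : ℝ :=
  ∑' g : G, if Abelianization.of g = q then μ g else 0

/-- The convolution powers of a probability measure are nonnegative and summable, and integrating a
bounded harmonic function against a translate of them reproduces the function. -/
theorem hasSum_convPow_mul {G : Type*} [Group G] {μ : G → ℝ} (hprob : IsProbMeasure μ) (n : ℕ) :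
    (∀ g, 0 ≤ convPow μ n g) ∧ Summable (convPow μ n) ∧
      ∀ h : G → ℝ, (∃ M : ℝ, ∀ x, |h x| ≤ M) → IsHarmonic μ h →
        ∀ k, HasSum (fun g => convPow μ n g * h (k * g)) (h k) := by
  classical
  induction n with
  | zero =>
    have h_single : ∀ h : G → ℝ, HasSum (fun g => convPow μ 0 g * h g) (h 1) := fun h => by
      simpa [convPow] using hasSum_single (f := fun g => convPow μ 0 g * h g) 1
        fun g hg => by simp [convPow, hg]
    refine ⟨fun g => ?_, ?_, fun h _ _ k => ?_⟩
    · simp only [convPow]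
      split_ifs <;> norm_num
    · simpa using (h_single fun _ => 1).summable
    · simpa using h_single fun g => h (k * g)
  | succ n ih =>
    obtain ⟨h_nonneg, h_sum, h_repr⟩ := ih
    have h_step : ∀ h : G → ℝ, (∃ M : ℝ, ∀ x, |h x| ≤ M) → IsHarmonic μ h →
        ∀ k, HasSum (fun g => convPow μ (n + 1) g * h (k * g)) (h k) := by
      intro h ⟨M, hM⟩ hharm k
      have h_prod : Summable fun p : G × G => convPow μ n p.1 * μ p.2 :=
        h_sum.mul_of_nonneg hprob.2.summable h_nonneg hprob.1
      have h_pair : Summable fun p : G × G =>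
          convPow μ n p.1 * μ p.2 * h (k * p.1 * p.2) := by
        refine Summable.of_norm_bounded (h_prod.mul_right M) fun p => ?_
        rw [norm_mul, Real.norm_of_nonneg (mul_nonneg (h_nonneg _) (hprob.1 _))]
        exact mul_le_mul_of_nonneg_left (hM _) (mul_nonneg (h_nonneg _) (hprob.1 _))
      have h_total : HasSum (fun p : G × G =>
          convPow μ n p.1 * μ p.2 * h (k * p.1 * p.2)) (h k) := by
        have h_fib := h_pair.hasSum.prod_fiberwise fun g => by
          simpa only [mul_assoc] using (hharm (k * g)).mul_left (convPow μ n g)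
        rw [(h_repr h ⟨M, hM⟩ hharm k).unique h_fib]
        exact h_pair.hasSum
      let e : G × G ≃ G × G :=
        { toFun := fun p => (p.2, p.2⁻¹ * p.1)
          invFun := fun p => (p.1 * p.2, p.1)
          left_inv := fun p => by simp
          right_inv := fun p => by simp }
      have h_prod' : Summable fun p : G × G => convPow μ n p.2 * μ (p.2⁻¹ * p.1) :=
        e.summable_iff.mpr h_prod
      refine ((e.hasSum_iff.mpr h_total).prod_fiberwise fun x => ?_)
      simpa [e, mul_assoc, convPow] using
        (h_prod'.prod_factor x).hasSum.mul_right (h (k * x))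
    have h_one : IsHarmonic μ fun _ => 1 := fun k => by simpa using hprob.2
    refine ⟨fun g => tsum_nonneg fun x => mul_nonneg (h_nonneg x) (hprob.1 _), ?_, h_step⟩
    simpa using (h_step (fun _ => 1) ⟨1, by simp⟩ h_one 1).summable

/-- A bounded harmonic function is invariant under central elements along which the convolution
powers disperse. -/
theorem IsHarmonic.mul_right_eq_of_tendsto_tvDist {G : Type*} [Group G] {μ : G → ℝ}
    (hprob : IsProbMeasure μ) {h : G → ℝ} (hbdd : ∃ M : ℝ, ∀ x, |h x| ≤ M)
    (hharm : IsHarmonic μ h) {z : G} (hz : z ∈ Subgroup.center G)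
    (hdisp : Tendsto (fun n : ℕ => tvDist (convPow μ n) (fun y => convPow μ n (y * z⁻¹)))
      atTop (𝓝 0)) (g : G) :
    h (g * z) = h g := by
  obtain ⟨M, hM⟩ := hbdd
  have h_bound : ∀ n, |h g - h (g * z)| ≤
      2 * M * tvDist (convPow μ n) (fun y => convPow μ n (y * z⁻¹)) := by
    intro n
    obtain ⟨-, h_sum, h_repr⟩ := hasSum_convPow_mul hprob n
    have h_shift : HasSum (fun x => convPow μ n (x * z⁻¹) * h (g * x)) (h (g * z)) := by
      rw [← (Equiv.mulRight z).hasSum_iff]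
      convert h_repr h ⟨M, hM⟩ hharm (g * z) using 2 with x
      have h_comm : g * (x * z) = g * z * x := by
        rw [Subgroup.mem_center_iff.mp hz x, mul_assoc]
      simp [h_comm]
    have h_diff := (h_repr h ⟨M, hM⟩ hharm g).sub h_shift
    have h_abs : Summable fun x => |convPow μ n x - convPow μ n (x * z⁻¹)| :=
      (h_sum.sub ((Equiv.mulRight z⁻¹).summable_iff.mpr h_sum)).abs
    have h_le := tsum_of_norm_bounded (h_abs.hasSum.mul_right M)
      (f := fun x => convPow μ n x * h (g * x) - convPow μ n (x * z⁻¹) * h (g * x)) fun x => by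
        rw [← sub_mul, norm_mul]
        exact mul_le_mul_of_nonneg_left (hM _) (abs_nonneg _)
    rw [h_diff.tsum_eq, Real.norm_eq_abs] at h_le
    refine h_le.trans_eq ?_
    unfold tvDist
    ring
  have h_lim := hdisp.const_mul (2 * M)
  rw [mul_zero] at h_lim
  have h_zero := abs_nonpos_iff.mp (ge_of_tendsto' h_lim h_bound)
  linarith

/-- A function on the abelianization whose pullback is harmonic is harmonic for the pushforward
measure. -/
theorem isHarmonic_abelianizationPush {G : Type*} [Group G] {μ : G → ℝ} (hμ : Summable μ)
    {u : Abelianization G → ℝ} (hu : IsHarmonic μ fun g => u (Abelianization.of g)) :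
    IsHarmonic (abelianizationPush μ) u := by
  classical
  intro k
  obtain ⟨k, rfl⟩ : ∃ g : G, Abelianization.of g = k := QuotientGroup.mk_surjective k
  have h_sigma := (Equiv.sigmaFiberEquiv (Abelianization.of : G → Abelianization G)).hasSum_iff.mpr
    (hu k)
  refine h_sigma.sigma fun q => ?_
  have h_fiber := (hμ.subtype {g | Abelianization.of g = q}).hasSum.mul_right
    (u (Abelianization.of k * q))
  have h_push : abelianizationPush μ q =
      ∑' g : {g : G | Abelianization.of g = q}, (μ ∘ Subtype.val) g := by
    refine Eq.trans (tsum_congr fun g => ?_) (tsum_subtype {g : G | Abelianization.of g = q} μ).symm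
    simp [Set.indicator_apply]
  rw [h_push]
  have h_eq : (fun g : {g : G // Abelianization.of g = q} =>
      μ g * u (Abelianization.of (k * g))) = fun g => μ g.1 * u (Abelianization.of k * q) :=
    funext fun g => by rw [map_mul, g.2]
  exact (congrArg (HasSum · _) h_eq).mpr h_fiber

/-- On a nilpotent group of class at most 2, the dispersion
property along the centre forces every bounded harmonic function to be invariant
under `[G,G]` and hence to factor through the abelianisation, the factor being
harmonic for the pushforward measure. -/
theorem bounded_harmonic_factors_through_abelianization
    {G : Type*} [Group G] (hFG : Group.FG G)
    (hclass2 : commutator G ≤ Subgroup.center G)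
    (μ : G → ℝ) (hprob : IsProbMeasure μ) (hsym : IsSymmetricMeasure μ)
    (hnd : IsNonDegenerate μ)
    (hdisp : ∀ z ∈ Subgroup.center G,
      Tendsto (fun n : ℕ => tvDist (convPow μ n) (fun y => convPow μ n (y * z⁻¹)))
        atTop (nhds 0)) :
    ∀ h : G → ℝ, (∃ M : ℝ, ∀ x, |h x| ≤ M) → IsHarmonic μ h →
      (∀ g : G, ∀ z ∈ commutator G, h (g * z) = h g) ∧
      ∃ hab : Abelianization G → ℝ,
        (∀ g : G, h g = hab (Abelianization.of g)) ∧
        IsHarmonic (abelianizationPush μ) hab := by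
  intro h hbdd hharm
  have h_inv : ∀ g : G, ∀ z ∈ commutator G, h (g * z) = h g := fun g z hz =>
    hharm.mul_right_eq_of_tendsto_tvDist hprob hbdd (hclass2 hz) (hdisp z (hclass2 hz)) g
  have h_rel : ∀ a b : G, QuotientGroup.leftRel (commutator G) a b → h a = h b := fun a b hab => by
    simpa using (h_inv a _ (QuotientGroup.leftRel_apply.mp hab)).symm
  exact ⟨h_inv, Quotient.lift h h_rel, fun g => rfl,
    isHarmonic_abelianizationPush hprob.2.summable hharm⟩
end
end

section
/- Let A be a finitely generated group, let ν be a symmetric, non-degenerate probability measure on A, and let B ≤ A be a subgroup of finite index. Suppose f : A → (0,∞) is ν-harmonic on A and multiplicative on B (that is, f(b₁b₂) = f(b₁)f(b₂) for all b₁, b₂ ∈ B). Then f is constant. -/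
open Filter Topology

noncomputable section

/-- A property of group elements that is preserved by right multiplication by the support of a
non-degenerate measure holds everywhere as soon as it holds at one point. -/
theorem IsNonDegenerate.forall_of_invariant {G : Type*} [Group G] {μ : G → ℝ}
    (hnd : IsNonDegenerate μ) {p : G → Prop} (hp : ∀ x g, μ g ≠ 0 → p x → p (x * g))
    {x₀ : G} (h₀ : p x₀) (x : G) : p x := by
  have key : ∀ g ∈ Subsemigroup.closure {g : G | μ g ≠ 0}, ∀ x, p x → p (x * g) := by
    intro g hg
    induction hg using Subsemigroup.closure_induction with
    | mem g hg => exact fun x hx => hp x g hg hx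
    | mul a b _ _ iha ihb =>
      intro x hx
      rw [← mul_assoc]
      exact ihb _ (iha _ hx)
  have hmem : x₀⁻¹ * x ∈ Subsemigroup.closure {g : G | μ g ≠ 0} := by
    rw [show Subsemigroup.closure {g : G | μ g ≠ 0} = ⊤ from hnd]
    trivial
  simpa using key _ hmem x₀ h₀

/-- Harnack inequality for a fixed positive harmonic function. -/
theorem IsHarmonic.exists_mul_le {G : Type*} [Group G] {μ f : G → ℝ}
    (hf : IsHarmonic μ f) (hμ : ∀ g, 0 ≤ μ g) (hnd : IsNonDegenerate μ)
    (hpos : ∀ x, 0 < f x) (g : G) : ∃ c : ℝ, 0 < c ∧ ∀ x, c * f (x * g) ≤ f x := by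
  have hmem : g ∈ Subsemigroup.closure {g : G | μ g ≠ 0} := by
    rw [show Subsemigroup.closure {g : G | μ g ≠ 0} = ⊤ from hnd]
    trivial
  induction hmem using Subsemigroup.closure_induction with
  | mem g hg =>
    exact ⟨μ g, lt_of_le_of_ne (hμ g) (Ne.symm hg), fun x =>
      le_hasSum (hf x) g fun b _ => mul_nonneg (hμ b) (hpos _).le⟩
  | mul a b _ _ iha ihb =>
    obtain ⟨c, hc, hca⟩ := iha
    obtain ⟨d, hd, hdb⟩ := ihb
    refine ⟨c * d, mul_pos hc hd, fun x => ?_⟩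
    calc c * d * f (x * (a * b)) = c * (d * f (x * a * b)) := by rw [mul_assoc, mul_assoc]
      _ ≤ c * f (x * a) := mul_le_mul_of_nonneg_left (hdb _) hc.le
      _ ≤ f x := hca x

/-- Minimum principle: a harmonic function attaining its minimum is constant. -/
theorem IsHarmonic.eq_of_forall_le {G : Type*} [Group G] {μ f : G → ℝ}
    (hf : IsHarmonic μ f) (hμ : IsProbMeasure μ) (hnd : IsNonDegenerate μ)
    {x₀ : G} (hmin : ∀ x, f x₀ ≤ f x) (x : G) : f x = f x₀ := by
  refine hnd.forall_of_invariant (p := fun x => f x = f x₀) (fun x g hg hx => ?_) rfl x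
  have hsum : HasSum (fun g => μ g * (f (x * g) - f x₀)) 0 := by
    have := (hf x).sub (hμ.2.mul_right (f x₀))
    simpa only [mul_sub, one_mul, hx, sub_self] using this
  have hzero := congrFun ((hasSum_zero_iff_of_nonneg fun g =>
    mul_nonneg (hμ.1 g) (sub_nonneg.2 (hmin _))).1 hsum) g
  exact sub_eq_zero.1 ((mul_eq_zero.1 hzero).resolve_left hg)

theorem two_le_add_inv {t : ℝ} (ht : 0 < t) : 2 ≤ t + t⁻¹ := by
  have h : t + t⁻¹ - 2 = (t - 1) ^ 2 / t := by field_simp; ring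
  have : 0 ≤ (t - 1) ^ 2 / t := by positivity
  linarith

theorem eq_one_of_add_inv_eq_two {t : ℝ} (ht : 0 < t) (h : t + t⁻¹ = 2) : t = 1 := by
  field_simp at h
  nlinarith [sq_nonneg (t - 1)]

/-- For a symmetric measure, a positive superharmonic function which is multiplied by a constant
under left translation by each element of a finite-index subgroup is constant along the steps of
the random walk. -/
theorem superharmonic_equivariant_step_eq {G : Type*} [Group G] {μ : G → ℝ}
    (hμ : IsProbMeasure μ) (hsym : IsSymmetricMeasure μ)
    (B : Subgroup G) [B.FiniteIndex] {u χ : G → ℝ} (hpos : ∀ x, 0 < u x)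
    (hχ : ∀ b ∈ B, χ b ≠ 0) (hequiv : ∀ b ∈ B, ∀ x, u (b * x) = χ b * u x)
    (hsummable : ∀ x, Summable fun g => μ g * u (x * g))
    (hsuper : ∀ x, ∑' g, μ g * u (x * g) ≤ u x)
    (x g : G) (hg : μ g ≠ 0) : u (x * g) = u x := by
  have : Fintype (G ⧸ B) := Fintype.ofFinite _
  let R : G ⧸ B → G → ℝ := fun q a => u (q.out⁻¹ * a) / u q.out⁻¹
  have hR : ∀ y a, R (QuotientGroup.mk y) a = u (y⁻¹ * a) / u y⁻¹ := by
    intro y a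
    obtain ⟨b, hb⟩ := QuotientGroup.mk_out_eq_mul B y
    have hb' := B.inv_mem b.2
    simp only [R, hb, mul_inv_rev, mul_assoc]
    rw [hequiv _ hb', hequiv _ hb', mul_div_mul_left _ _ (hχ _ hb')]
  have hRpos : ∀ q a, 0 < R q a := fun q a => div_pos (hpos _) (hpos _)
  let T : G → ℝ := fun a => ∑ q, R q a
  have hTinv : ∀ a, T a⁻¹ = ∑ q, (R q a)⁻¹ := by
    intro a
    change ∑ q, R q a⁻¹ = _
    rw [← Equiv.sum_comp (MulAction.toPerm a⁻¹ : Equiv.Perm (G ⧸ B)) (fun q => R q a⁻¹)]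
    refine Finset.sum_congr rfl fun q _ => ?_
    induction q using QuotientGroup.induction_on with
    | H y =>
      rw [MulAction.toPerm_apply, MulAction.Quotient.smul_mk, hR, hR]
      simp
  have hRsum : ∀ q, Summable fun a => μ a * R q a := fun q => by
    simpa only [R, mul_div_assoc] using (hsummable q.out⁻¹).div_const (u q.out⁻¹)
  have hRle : ∀ q, ∑' a, μ a * R q a ≤ 1 := fun q => by
    simp only [R, ← mul_div_assoc]
    rw [tsum_div_const]
    exact (div_le_one (hpos _)).2 (hsuper _)
  have hTsum : Summable fun a => μ a * T a := by
    simp only [T, Finset.mul_sum]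
    exact summable_sum fun q _ => hRsum q
  have hTle : ∑' a, μ a * T a ≤ Fintype.card (G ⧸ B) := by
    simp only [T, Finset.mul_sum]
    rw [Summable.tsum_finsetSum fun q _ => hRsum q]
    calc _ ≤ ∑ _q : G ⧸ B, (1 : ℝ) := Finset.sum_le_sum fun q _ => hRle q
      _ = _ := by simp
  have hTinvSum : HasSum (fun a => μ a * T a⁻¹) (∑' a, μ a * T a) := by
    have := (Equiv.hasSum_iff (Equiv.inv G)).2 hTsum.hasSum
    refine this.congr_fun fun a => ?_
    simp [← hsym a]
  have hpair : ∀ a, T a + T a⁻¹ - 2 * Fintype.card (G ⧸ B) =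
      ∑ q, (R q a + (R q a)⁻¹ - 2) := by
    intro a
    rw [hTinv, Finset.sum_sub_distrib, Finset.sum_add_distrib]
    simp [T, mul_comm]
  have hterm : ∀ q a, 0 ≤ R q a + (R q a)⁻¹ - 2 := fun q a =>
    sub_nonneg.2 (two_le_add_inv (hRpos q a))
  have hsum : HasSum (fun a => μ a * ∑ q, (R q a + (R q a)⁻¹ - 2))
      (∑' a, μ a * T a + ∑' a, μ a * T a - 1 * (2 * Fintype.card (G ⧸ B))) := by
    simp only [← hpair, mul_sub, mul_add]
    exact (hTsum.hasSum.add hTinvSum).sub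
      (hμ.2.mul_right (2 * (Fintype.card (G ⧸ B) : ℝ)))
  have hle := le_hasSum hsum g fun a _ =>
    mul_nonneg (hμ.1 a) (Finset.sum_nonneg fun q _ => hterm q a)
  have hgpos : 0 < μ g := lt_of_le_of_ne (hμ.1 g) hg.symm
  have hzero : ∑ q, (R q g + (R q g)⁻¹ - 2) = 0 := by
    refine le_antisymm ?_ (Finset.sum_nonneg fun q _ => hterm q g)
    by_contra! hlt
    linarith [mul_pos hgpos hlt]
  have hq := (Finset.sum_eq_zero_iff_of_nonneg fun q _ => hterm q g).1 hzero
    (QuotientGroup.mk x⁻¹) (Finset.mem_univ _)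
  have hone := eq_one_of_add_inv_eq_two (hRpos _ _) (sub_eq_zero.1 hq)
  rw [hR, inv_inv] at hone
  exact (div_eq_one_iff_eq (hpos x).ne').1 hone

/-- (No nontrivial multiplicative positive harmonic functions for
symmetric measures.) If `f : A → (0,∞)` is `ν`-harmonic and multiplicative on a
finite-index subgroup `B`, then `f` is constant. -/
theorem multiplicative_positive_harmonic_is_constant
    {A : Type*} [Group A] (hFG : Group.FG A)
    (ν : A → ℝ) (hprob : IsProbMeasure ν) (hsym : IsSymmetricMeasure ν)
    (hnd : IsNonDegenerate ν)
    (B : Subgroup A) (hB : B.FiniteIndex)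
    (f : A → ℝ) (hfpos : ∀ x, 0 < f x) (hfharm : IsHarmonic ν f)
    (hfmul : ∀ b₁ ∈ B, ∀ b₂ ∈ B, f (b₁ * b₂) = f b₁ * f b₂) :
    ∀ x y : A, f x = f y := by
  have hf1 : f 1 = 1 := by
    have h := hfmul 1 B.one_mem 1 B.one_mem
    rw [mul_one] at h
    exact (mul_eq_left₀ (hfpos 1).ne').1 h.symm
  let u : A → ℝ := fun x => ⨅ b : B, f (b * x) / f b
  have hbdd : ∀ x, BddBelow (Set.range fun b : B => f (b * x) / f b) := fun x =>
    ⟨0, by rintro _ ⟨b, rfl⟩; exact (div_pos (hfpos _) (hfpos _)).le⟩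
  have hule : ∀ x (b : B), u x ≤ f (b * x) / f b := fun x b => ciInf_le (hbdd x) b
  have hupos : ∀ x, 0 < u x := by
    intro x
    obtain ⟨c, hc, hcle⟩ := hfharm.exists_mul_le hprob.1 hnd hfpos x⁻¹
    refine hc.trans_le (le_ciInf fun b => ?_)
    rw [le_div_iff₀ (hfpos _)]
    simpa using hcle (b * x)
  have hequiv : ∀ b ∈ B, ∀ x, u (b * x) = f b * u x := by
    intro b hb x
    simp only [u]
    rw [Real.mul_iInf_of_nonneg (hfpos b).le,
      ← Equiv.iInf_comp (g := fun b' : B => f b * (f (b' * x) / f b'))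
        (Equiv.mulRight (⟨b, hb⟩ : B))]
    congr 1
    funext b'
    have := (hfpos b).ne'
    have := (hfpos b').ne'
    simp only [Equiv.coe_mulRight, Subgroup.coe_mul, hfmul b' b'.2 b hb, mul_assoc]
    field_simp
  have hu1 : u 1 = 1 := by
    have : ∀ b : B, f (b * 1) / f b = 1 := fun b => by
      rw [mul_one, div_self (hfpos _).ne']
    simp only [u, this, ciInf_const]
  have hshift : ∀ x (b : B),
      HasSum (fun a => ν a * (f (b * (x * a)) / f b)) (f (b * x) / f b) := fun x b => by
    simpa only [mul_assoc, mul_div_assoc] using (hfharm (b * x)).div_const (f b)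
  have hstep_le : ∀ x (b : B) a, ν a * u (x * a) ≤ ν a * (f (b * (x * a)) / f b) :=
    fun x b a => mul_le_mul_of_nonneg_left (hule _ b) (hprob.1 a)
  have hsummable : ∀ x, Summable fun a => ν a * u (x * a) := fun x =>
    Summable.of_nonneg_of_le (fun a => mul_nonneg (hprob.1 a) (hupos _).le)
      (hstep_le x 1) (hshift x 1).summable
  have hsuper : ∀ x, ∑' a, ν a * u (x * a) ≤ u x := fun x => le_ciInf fun b =>
    hasSum_le (hstep_le x b) (hsummable x).hasSum (hshift x b)
  have hu : ∀ x, u x = 1 := hnd.forall_of_invariant (fun x a ha hx =>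
    (superharmonic_equivariant_step_eq hprob hsym B hupos (fun b _ => (hfpos b).ne') hequiv
      hsummable hsuper x a ha).trans hx) hu1
  have hmin : ∀ x, f 1 ≤ f x := fun x => by
    simpa [hf1, hu x] using hule x 1
  intro x y
  rw [hfharm.eq_of_forall_le hprob hnd hmin x, hfharm.eq_of_forall_le hprob hnd hmin y]
end
end
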